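/- Let S_t^{(−μ)} be the (1/2)-stable subordinator with drift −μ < 0 and A_t^{(−μ)} its positive sojourn time, and set b := 1/(4μ). Then for all q, λ > 0, the double Laplace transform satisfies ∫_0^∞ e^{−qt} E[exp(−λ A_t^{(−μ)})] dt = (1/(q+λ)) · ( (√b + √(q+λ+b)) / (√b + √(q+b)) )². -/

import Mathlib

open MeasureTheory ProbabilityTheory Real Set Filter

noncomputable section

variable {Ω : Type*} [MeasurableSpace Ω]

/-- A standard one-dimensional Brownian motion started at `0`: continuous paths a.s.,
`B 0 = 0` a.s., Gaussian increments `B t - B s ~ N(0, t-s)`, and increments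
independent of the past. -/
structure IsBrownianMotion (P : Measure Ω) (B : ℝ → Ω → ℝ) : Prop where
  measurable : ∀ t, Measurable (B t)
  start : ∀ᵐ ω ∂P, B 0 ω = 0
  cont : ∀ᵐ ω ∂P, Continuous fun t => B t ω
  gauss : ∀ s t : ℝ, 0 ≤ s → s ≤ t →
      P.map (fun ω => B t ω - B s ω) = gaussianReal 0 (Real.toNNReal (t - s))
  indep : ∀ s t : ℝ, 0 ≤ s → s ≤ t → ∀ (n : ℕ) (u : Fin n → ℝ),
      (∀ i, 0 ≤ u i ∧ u i ≤ s) →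
      IndepFun (fun ω => B t ω - B s ω) (fun ω (i : Fin n) => B (u i) ω) P

/-- The `(1/2)`-stable subordinator constructed from Brownian motion `B`:
`S_t := inf {s > 0 : B_s = t/√2}`. -/
def stableHalfSubordinator (B : ℝ → Ω → ℝ) (t : ℝ) (ω : Ω) : ℝ :=
  sInf {s : ℝ | 0 < s ∧ B s ω = t / Real.sqrt 2}

/-- The positive sojourn time of the `(1/2)`-stable subordinator with drift `-μ`:
`A_t^{(-μ)} := ∫_0^t 1{S_s - μ s > 0} ds`. -/
def sojournDrift (B : ℝ → Ω → ℝ) (μ : ℝ) (t : ℝ) (ω : Ω) : ℝ :=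
  ∫ s in (0:ℝ)..t, (if 0 < stableHalfSubordinator B s ω - μ * s then (1:ℝ) else 0)

open scoped ENNReal Topology

lemma lintegral_gaussian_unit :
    ∫⁻ x : ℝ, ENNReal.ofReal (exp (-x ^ 2)) = ENNReal.ofReal (√π) := by
  have hi : Integrable (fun x : ℝ => exp (-x ^ 2)) := by
    simpa using integrable_exp_neg_mul_sq (b := 1) one_pos
  rw [← ofReal_integral_eq_lintegral_ofReal hi (ae_of_all _ fun x => (exp_pos _).le)]
  congr 1
  simpa using integral_gaussian 1

lemma hasDerivAt_sqrt_sub_inv_sqrt (p w : ℝ) {s : ℝ} (hs : 0 < s) :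
    HasDerivAt (fun s => p * √s - w / √s) (p / (2 * √s) + w / (2 * (s * √s))) s := by
  have h := (hasDerivAt_sqrt hs.ne')
  have hq : √s ≠ 0 := (sqrt_pos.2 hs).ne'
  have h2 := (h.const_mul p).sub ((hasDerivAt_const s w).div h hq)
  refine h2.congr_deriv ?_
  rw [sq_sqrt hs.le]
  field_simp
  ring

/-- The Cauchy–Schlömilch substitution. -/
lemma lintegral_cauchy_schlomilch {p w : ℝ} (hp : 0 < p) (hw : 0 < w) :
    ∫⁻ s in Ioi (0 : ℝ), ENNReal.ofReal
      ((p / (2 * √s) + w / (2 * (s * √s))) * exp (-p ^ 2 * s - w ^ 2 / s))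
      = ENNReal.ofReal (√π * exp (-2 * p * w)) := by
  have hinj : StrictMonoOn (fun s => p * √s - w / √s) (Ioi 0) := by
    intro x hx y hy hxy
    have h1 : √x < √y := sqrt_lt_sqrt (le_of_lt hx) hxy
    have h0 : 0 < √x := sqrt_pos.2 hx
    have h2 : w / √y < w / √x := div_lt_div_of_pos_left hw h0 h1
    have h3 : p * √x < p * √y := mul_lt_mul_of_pos_left h1 hp
    simp only
    linarith
  have himg : (fun s => p * √s - w / √s) '' Ioi 0 = univ := by
    refine eq_univ_of_forall fun y => ?_
    have hpw : 0 < p * w := mul_pos hp hw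
    set d := √(y ^ 2 + 4 * (p * w)) with hd
    have hd2 : d ^ 2 = y ^ 2 + 4 * (p * w) := sq_sqrt (by positivity)
    have hdy : |y| < d := by
      rw [← sqrt_sq_eq_abs]; exact sqrt_lt_sqrt (sq_nonneg _) (by linarith)
    have hpos : 0 < y + d := by linarith [neg_abs_le y]
    set u := (y + d) / (2 * p) with hu
    have hupos : 0 < u := by positivity
    refine ⟨u ^ 2, by simp only [mem_Ioi]; positivity, ?_⟩
    simp only [sqrt_sq hupos.le]
    rw [sub_eq_iff_eq_add, hu]
    field_simp
    nlinarith
  have key := lintegral_image_eq_lintegral_abs_deriv_mul (measurableSet_Ioi (a := (0 : ℝ)))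
    (fun s hs => (hasDerivAt_sqrt_sub_inv_sqrt p w hs).hasDerivWithinAt) hinj.injOn
    (fun x => ENNReal.ofReal (exp (-x ^ 2)))
  rw [himg, Measure.restrict_univ, lintegral_gaussian_unit] at key
  rw [mul_comm (√π), ENNReal.ofReal_mul (exp_pos _).le, key,
    ← lintegral_const_mul' _ _ ENNReal.ofReal_ne_top]
  refine setLIntegral_congr_fun measurableSet_Ioi fun s hs => ?_
  have hs' : 0 < s := hs
  have hq : 0 < √s := sqrt_pos.2 hs'
  have hpos : 0 ≤ p / (2 * √s) + w / (2 * (s * √s)) := by positivity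
  rw [abs_of_nonneg hpos, ← ENNReal.ofReal_mul hpos, ← ENNReal.ofReal_mul (exp_pos _).le]
  congr 1
  rw [mul_left_comm (exp _), ← exp_add]
  congr 2
  have : (p * √s - w / √s) ^ 2 = p ^ 2 * √s ^ 2 - 2 * p * w + w ^ 2 / √s ^ 2 := by
    field_simp; ring
  rw [this, sq_sqrt hs'.le]
  ring

lemma lintegral_inv_three_halves_eq {p w : ℝ} (hp : 0 < p) (hw : 0 < w) :
    ∫⁻ s in Ioi (0 : ℝ), ENNReal.ofReal (w / (2 * (s * √s)) * exp (-p ^ 2 * s - w ^ 2 / s))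
      = ∫⁻ s in Ioi (0 : ℝ), ENNReal.ofReal (p / (2 * √s) * exp (-p ^ 2 * s - w ^ 2 / s)) := by
  set κ : ℝ := w ^ 2 / p ^ 2 with hκ
  have hκ0 : 0 < κ := by positivity
  have hd : ∀ s ∈ Ioi (0 : ℝ), HasDerivWithinAt (fun s => κ / s) (-κ / s ^ 2) (Ioi 0) s := by
    intro s hs
    have := (hasDerivAt_const s κ).div (hasDerivAt_id s) (ne_of_gt hs)
    refine (this.congr_deriv ?_).hasDerivWithinAt
    simp
  have hinj : InjOn (fun s => κ / s) (Ioi (0 : ℝ)) := by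
    intro x hx y hy hxy
    have hx' : x ≠ 0 := ne_of_gt hx
    have hy' : y ≠ 0 := ne_of_gt hy
    simp only at hxy
    field_simp at hxy
    exact hxy.symm
  have himg : (fun s => κ / s) '' Ioi (0 : ℝ) = Ioi 0 := by
    ext y
    constructor
    · rintro ⟨s, hs, rfl⟩
      exact div_pos hκ0 hs
    · intro hy
      exact ⟨κ / y, div_pos hκ0 hy, by simp only; field_simp⟩
  have key := lintegral_image_eq_lintegral_abs_deriv_mul (measurableSet_Ioi (a := (0 : ℝ)))
    hd hinj
    (fun s => ENNReal.ofReal (w / (2 * (s * √s)) * exp (-p ^ 2 * s - w ^ 2 / s)))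
  rw [himg] at key
  rw [key]
  refine setLIntegral_congr_fun measurableSet_Ioi fun s hs => ?_
  have hs' : 0 < s := hs
  rw [← ENNReal.ofReal_mul (abs_nonneg _), ← mul_assoc]
  congr 2
  · rw [abs_div, abs_neg, abs_of_pos hκ0, abs_of_pos (by positivity : 0 < s ^ 2)]
    have h1 : √(κ / s) = w / p / √s := by
      rw [sqrt_div hκ0.le, hκ, sqrt_div (sq_nonneg _), sqrt_sq hw.le, sqrt_sq hp.le]
    have hq : 0 < √s := sqrt_pos.2 hs'
    have h2 : s = √s ^ 2 := (sq_sqrt hs'.le).symm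
    rw [h1, hκ]
    field_simp
    linear_combination (-1 : ℝ) * h2
  · rw [hκ]
    congr 1
    field_simp
    ring

lemma lintegral_inv_sqrt_mul_exp {p w : ℝ} (hp : 0 < p) (hw : 0 < w) :
    ∫⁻ s in Ioi (0 : ℝ), ENNReal.ofReal (p / (2 * √s) * exp (-p ^ 2 * s - w ^ 2 / s))
      = ENNReal.ofReal (√π / 2 * exp (-2 * p * w)) := by
  have h := lintegral_cauchy_schlomilch hp hw
  have h2 : ∀ s ∈ Ioi (0 : ℝ), ENNReal.ofReal
      ((p / (2 * √s) + w / (2 * (s * √s))) * exp (-p ^ 2 * s - w ^ 2 / s)) =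
      ENNReal.ofReal (p / (2 * √s) * exp (-p ^ 2 * s - w ^ 2 / s)) +
      ENNReal.ofReal (w / (2 * (s * √s)) * exp (-p ^ 2 * s - w ^ 2 / s)) := by
    intro s hs
    have hs' : 0 < s := hs
    rw [add_mul, ENNReal.ofReal_add (by positivity) (by positivity)]
  rw [setLIntegral_congr_fun measurableSet_Ioi h2, lintegral_add_left (by fun_prop),
    lintegral_inv_three_halves_eq hp hw, ← two_mul] at h
  have h3 : ENNReal.ofReal (√π * exp (-2 * p * w)) =
      2 * ENNReal.ofReal (√π / 2 * exp (-2 * p * w)) := by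
    rw [← ENNReal.ofReal_ofNat 2, ← ENNReal.ofReal_mul (by norm_num)]
    congr 1; ring
  rw [h3] at h
  exact (ENNReal.mul_right_inj (by norm_num) (by norm_num)).1 h

/-- The density at `x > 0` of the `(1/2)`-stable law with Laplace transform `exp (-t √θ)`. -/
def stableHalfDensity (t x : ℝ) : ℝ := t / (2 * √π) * (1 / (x * √x)) * exp (-t ^ 2 / (4 * x))

@[fun_prop]
lemma measurable_stableHalfDensity : Measurable (fun p : ℝ × ℝ => stableHalfDensity p.1 p.2) := by
  unfold stableHalfDensity; fun_prop

lemma lintegral_exp_mul_stableHalfDensity {t θ : ℝ} (ht : 0 < t) (hθ : 0 < θ) :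
    ∫⁻ x in Ioi (0 : ℝ), ENNReal.ofReal (exp (-θ * x)) * ENNReal.ofReal (stableHalfDensity t x)
      = ENNReal.ofReal (exp (-t * √θ)) := by
  have hp : 0 < √θ := sqrt_pos.2 hθ
  have h := (lintegral_inv_three_halves_eq hp (half_pos ht)).trans
    (lintegral_inv_sqrt_mul_exp hp (half_pos ht))
  have hpi : 0 < √π := sqrt_pos.2 pi_pos
  have h2 : ENNReal.ofReal (exp (-t * √θ)) =
      ENNReal.ofReal (2 / √π) * ENNReal.ofReal (√π / 2 * exp (-2 * √θ * (t / 2))) := by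
    rw [← ENNReal.ofReal_mul (by positivity)]
    congr 1
    rw [← mul_assoc, div_mul_div_cancel₀ (by positivity), div_self two_ne_zero, one_mul]
    congr 1; ring
  rw [h2, ← h, ← lintegral_const_mul' _ _ ENNReal.ofReal_ne_top]
  refine setLIntegral_congr_fun measurableSet_Ioi fun x hx => ?_
  have hx' : 0 < x := hx
  have hq : 0 < √x := sqrt_pos.2 hx'
  rw [← ENNReal.ofReal_mul (exp_pos _).le, ← ENNReal.ofReal_mul (by positivity)]
  congr 1
  rw [sq_sqrt hθ.le, stableHalfDensity]
  have : exp (-θ * x - (t / 2) ^ 2 / x) = exp (-θ * x) * exp (-t ^ 2 / (4 * x)) := by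
    rw [← exp_add]; congr 1; field_simp; ring
  rw [this]
  field_simp

lemma lintegral_stableHalfDensity {t : ℝ} (ht : 0 < t) :
    ∫⁻ x in Ioi (0 : ℝ), ENNReal.ofReal (stableHalfDensity t x) = 1 := by
  have hlim : Tendsto (fun n : ℕ => (1 : ℝ) / (n + 1)) atTop (𝓝 0) :=
    tendsto_one_div_add_atTop_nhds_zero_nat
  have h1 : Tendsto (fun n : ℕ => ∫⁻ x in Ioi (0 : ℝ), ENNReal.ofReal (exp (-(1 / (n + 1)) * x)) *
      ENNReal.ofReal (stableHalfDensity t x)) atTop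
      (𝓝 (∫⁻ x in Ioi (0 : ℝ), ENNReal.ofReal (stableHalfDensity t x))) := by
    refine lintegral_tendsto_of_tendsto_of_monotone (fun n => ?_) ?_ ?_
    · have : Measurable (fun x => stableHalfDensity t x) :=
        measurable_stableHalfDensity.comp measurable_prodMk_left
      fun_prop
    · refine (ae_restrict_iff' measurableSet_Ioi).2 (ae_of_all _ fun x hx n m hnm => ?_)
      simp only
      gcongr
      exact le_of_lt hx
    · refine ae_of_all _ fun x => ?_
      have h : Tendsto (fun n : ℕ => ENNReal.ofReal (exp (-((1 : ℝ) / (n + 1)) * x))) atTop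
          (𝓝 1) := by
        rw [← ENNReal.ofReal_one]
        refine ENNReal.tendsto_ofReal ?_
        have := ((hlim.neg).mul_const x).rexp
        simpa using this
      simpa using ENNReal.Tendsto.mul_const h (Or.inl one_ne_zero)
  have h2 : Tendsto (fun n : ℕ => ENNReal.ofReal (exp (-t * √(1 / (n + 1))))) atTop (𝓝 1) := by
    rw [← ENNReal.ofReal_one]
    refine ENNReal.tendsto_ofReal ?_
    have := (((continuous_sqrt.tendsto 0).comp hlim).const_mul (-t)).rexp
    simpa [Function.comp_def] using this
  refine tendsto_nhds_unique h1 (h2.congr fun n => ?_)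
  rw [lintegral_exp_mul_stableHalfDensity ht (by positivity)]

/-- The `r`-potential measure of the `(1/2)`-stable subordinator with drift `-μ`. -/
def potential (μ r : ℝ) : Measure ℝ :=
  (((volume.restrict (Ioi (0 : ℝ))).prod (volume.restrict (Ioi (0 : ℝ)))).withDensity
    fun p => ENNReal.ofReal (exp (-r * p.1)) * ENNReal.ofReal (stableHalfDensity p.1 p.2)).map
    fun p => p.2 - μ * p.1

lemma lintegral_potential (μ r : ℝ) {f : ℝ → ℝ≥0∞} (hf : Measurable f) :
    ∫⁻ z, f z ∂(potential μ r) = ∫⁻ t in Ioi (0 : ℝ), ENNReal.ofReal (exp (-r * t)) *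
      ∫⁻ x in Ioi (0 : ℝ), ENNReal.ofReal (stableHalfDensity t x) * f (x - μ * t) := by
  have hm : Measurable fun p : ℝ × ℝ => p.2 - μ * p.1 := by fun_prop
  have hd : Measurable fun p : ℝ × ℝ =>
      ENNReal.ofReal (exp (-r * p.1)) * ENNReal.ofReal (stableHalfDensity p.1 p.2) := by fun_prop
  rw [potential, lintegral_map hf hm, lintegral_withDensity_eq_lintegral_mul _ hd (by fun_prop),
    lintegral_prod _ (by fun_prop)]
  refine lintegral_congr fun t => ?_
  rw [← lintegral_const_mul' _ _ ENNReal.ofReal_ne_top]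
  refine lintegral_congr fun x => ?_
  simp only [Pi.mul_apply]
  rw [mul_assoc]

lemma lintegral_exp_neg_mul_Ioi {c : ℝ} (hc : 0 < c) :
    ∫⁻ t in Ioi (0 : ℝ), ENNReal.ofReal (exp (-c * t)) = ENNReal.ofReal (1 / c) := by
  rw [← ofReal_integral_eq_lintegral_ofReal (integrableOn_exp_mul_Ioi (by linarith) 0)
    (ae_of_all _ fun x => (exp_pos _).le), integral_exp_mul_Ioi (by linarith)]
  simp

lemma lintegral_exp_potential {μ r θ : ℝ} (hθ : 0 < θ) (hr : μ * θ - √θ < r) :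
    ∫⁻ z, ENNReal.ofReal (exp (-θ * z)) ∂(potential μ r)
      = ENNReal.ofReal (1 / (r - (μ * θ - √θ))) := by
  rw [lintegral_potential μ r (by fun_prop), ← lintegral_exp_neg_mul_Ioi (sub_pos.2 hr)]
  refine setLIntegral_congr_fun measurableSet_Ioi fun t ht => ?_
  have : ∫⁻ x in Ioi (0 : ℝ), ENNReal.ofReal (stableHalfDensity t x) *
      ENNReal.ofReal (exp (-θ * (x - μ * t))) =
      ENNReal.ofReal (exp (θ * μ * t)) * ENNReal.ofReal (exp (-t * √θ)) := by
    rw [← lintegral_exp_mul_stableHalfDensity ht hθ,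
      ← lintegral_const_mul' _ _ ENNReal.ofReal_ne_top]
    refine lintegral_congr fun x => ?_
    rw [mul_comm, ← mul_assoc, ← ENNReal.ofReal_mul (exp_pos (θ * μ * t)).le, ← exp_add]
    ring_nf
  rw [this, ← ENNReal.ofReal_mul (exp_pos _).le, ← ENNReal.ofReal_mul (exp_pos _).le, ← exp_add,
    ← exp_add]
  ring_nf

lemma potential_univ (μ : ℝ) {r : ℝ} (hr : 0 < r) :
    potential μ r univ = ENNReal.ofReal (1 / r) := by
  rw [← lintegral_one, lintegral_potential μ r measurable_const, ← lintegral_exp_neg_mul_Ioi hr]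
  refine setLIntegral_congr_fun measurableSet_Ioi fun t ht => ?_
  simp only [mul_one]
  rw [lintegral_stableHalfDensity ht, mul_one]

/-- For fixed `z < 0`, the potential density at `z`. -/
lemma lintegral_potential_density {μ r w z : ℝ} (hμ : 0 < μ) (hw : 1 < 2 * μ * w)
    (hrw : μ * w ^ 2 - w = r) (hz : z < 0) :
    ∫⁻ t in Ioi (-z / μ), ENNReal.ofReal (exp (-r * t)) *
        ENNReal.ofReal (stableHalfDensity t (z + μ * t))
      = ENNReal.ofReal (2 * w / (2 * μ * w - 1) * exp (w ^ 2 * z)) := by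
  have hpi : 0 < √π := sqrt_pos.2 pi_pos
  set y := -z with hy
  have hy0 : 0 < y := by linarith
  set p := (2 * μ * w - 1) / (2 * μ) with hp
  have hp0 : 0 < p := by rw [hp]; apply div_pos <;> linarith
  have hv0 : 0 < y / (2 * μ) := by positivity
  have hw0 : 0 < w := by
    by_contra h
    have : 2 * μ * w ≤ 0 := mul_nonpos_of_nonneg_of_nonpos (by linarith) (not_lt.1 h)
    linarith
  have hp2 : p ^ 2 = r / μ + 1 / (4 * μ ^ 2) := by
    rw [hp, ← hrw]; field_simp; ring
  have himg : (fun s => (s + y) / μ) '' Ioi (0 : ℝ) = Ioi (y / μ) := by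
    ext t
    constructor
    · rintro ⟨s, hs, rfl⟩
      have hs' : 0 < s := hs
      simp only [mem_Ioi]
      gcongr
      linarith
    · intro ht
      refine ⟨μ * t - y, ?_, ?_⟩
      · have : y / μ < t := ht
        rw [div_lt_iff₀ hμ] at this
        simp only [mem_Ioi]; linarith
      · simp only; field_simp; ring
  have key := lintegral_image_eq_lintegral_abs_deriv_mul (measurableSet_Ioi (a := (0 : ℝ)))
    (f := fun s => (s + y) / μ) (f' := fun _ => 1 / μ)
    (fun s _ => (((hasDerivAt_id s).add_const y).div_const μ).hasDerivWithinAt)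
    (fun a _ b _ hab => by
      simp only at hab
      field_simp at hab
      linarith)
    (fun t => ENNReal.ofReal (exp (-r * t)) * ENNReal.ofReal (stableHalfDensity t (z + μ * t)))
  rw [himg] at key
  rw [key]
  have h1 := lintegral_inv_sqrt_mul_exp hp0 hv0
  have h2 := (lintegral_inv_three_halves_eq hp0 hv0).trans h1
  set E := exp (-r * y / μ - y / (2 * μ ^ 2)) with hE
  have hE0 : 0 < E := exp_pos _
  have hrhs : ENNReal.ofReal (2 * w / (2 * μ * w - 1) * exp (w ^ 2 * z)) =
      ENNReal.ofReal (E / (√π * μ ^ 2 * p)) *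
        ENNReal.ofReal (√π / 2 * exp (-2 * p * (y / (2 * μ)))) +
      ENNReal.ofReal (2 * E / (√π * μ)) *
        ENNReal.ofReal (√π / 2 * exp (-2 * p * (y / (2 * μ)))) := by
    rw [← ENNReal.ofReal_mul (by positivity), ← ENNReal.ofReal_mul (by positivity),
      ← ENNReal.ofReal_add (by positivity) (by positivity)]
    congr 1
    have hexp : exp (w ^ 2 * z) = E * exp (-2 * p * (y / (2 * μ))) := by
      rw [hE, ← exp_add]
      congr 1
      have hz' : z = -y := by rw [hy]; ring
      rw [hp, hz', ← hrw]
      field_simp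
      ring
    rw [hexp]
    have h3 : 2 * w / (2 * μ * w - 1) = 1 / (2 * μ ^ 2 * p) + 1 / μ := by
      have hd : 2 * μ * w - 1 ≠ 0 := by linarith
      have h4 : 2 * μ ^ 2 * p = μ * (2 * μ * w - 1) := by rw [hp]; field_simp
      rw [h4, div_add_div _ _ (mul_ne_zero hμ.ne' hd) hμ.ne',
        div_eq_div_iff hd (mul_ne_zero (mul_ne_zero hμ.ne' hd) hμ.ne')]
      ring
    rw [h3]
    field_simp
  rw [hrhs]
  nth_rewrite 1 [← h1]
  rw [← h2, ← lintegral_const_mul' _ _ ENNReal.ofReal_ne_top,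
    ← lintegral_const_mul' _ _ ENNReal.ofReal_ne_top, ← lintegral_add_left (by fun_prop)]
  refine setLIntegral_congr_fun measurableSet_Ioi fun s hs => ?_
  have hs' : 0 < s := hs
  have hq : 0 < √s := sqrt_pos.2 hs'
  have hzs : z + μ * ((s + y) / μ) = s := by rw [hy]; field_simp; ring
  rw [hzs, ← ENNReal.ofReal_mul (exp_pos _).le, ← ENNReal.ofReal_mul (abs_nonneg _),
    ← ENNReal.ofReal_mul (by positivity), ← ENNReal.ofReal_mul (by positivity),
    ← ENNReal.ofReal_add (by positivity) (by positivity)]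
  congr 1
  rw [abs_of_pos (by positivity), stableHalfDensity, hp2]
  have hexp : exp (-r * ((s + y) / μ)) * exp (-((s + y) / μ) ^ 2 / (4 * s)) =
      E * exp (-(r / μ + 1 / (4 * μ ^ 2)) * s - (y / (2 * μ)) ^ 2 / s) := by
    rw [hE, ← exp_add, ← exp_add]
    congr 1
    field_simp
    ring
  rw [mul_left_comm (exp _), hexp]
  field_simp

lemma setLIntegral_Iic_potential {μ r w : ℝ} (hμ : 0 < μ) (hw : 1 < 2 * μ * w)
    (hrw : μ * w ^ 2 - w = r) {f : ℝ → ℝ≥0∞} (hf : Measurable f) :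
    ∫⁻ z in Iic 0, f z ∂(potential μ r) =
      ∫⁻ z in Iio (0 : ℝ), ENNReal.ofReal (2 * w / (2 * μ * w - 1) * exp (w ^ 2 * z)) * f z := by
  rw [← lintegral_indicator measurableSet_Iic, lintegral_potential μ r
    (hf.indicator measurableSet_Iic)]
  set F := (Iic (0 : ℝ)).indicator f with hF
  have hFm : Measurable F := hf.indicator measurableSet_Iic
  set k : ℝ → ℝ → ℝ≥0∞ := fun t z => ENNReal.ofReal (exp (-r * t)) *
    ((Ioi (0 : ℝ)).indicator (fun x => ENNReal.ofReal (stableHalfDensity t x)) (z + μ * t) * F z)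
    with hk
  have hstep : ∀ t, ENNReal.ofReal (exp (-r * t)) *
      ∫⁻ x in Ioi (0 : ℝ), ENNReal.ofReal (stableHalfDensity t x) * F (x - μ * t) =
      ∫⁻ z, k t z := by
    intro t
    rw [hk, lintegral_const_mul' _ _ ENNReal.ofReal_ne_top, ← lintegral_indicator measurableSet_Ioi,
      ← lintegral_add_right_eq_self _ (μ * t)]
    congr 1
    refine lintegral_congr fun z => ?_
    rw [indicator_mul_left _ _ (fun x => F (x - μ * t))]
    simp
  have hkm : Measurable (Function.uncurry k) := by
    have h1 : Measurable fun p : ℝ × ℝ =>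
        (Ioi (0 : ℝ)).indicator (fun x => ENNReal.ofReal (stableHalfDensity p.1 x))
          (p.2 + μ * p.1) := by
      have : (fun p : ℝ × ℝ =>
        (Ioi (0 : ℝ)).indicator (fun x => ENNReal.ofReal (stableHalfDensity p.1 x))
          (p.2 + μ * p.1)) = {p : ℝ × ℝ | 0 < p.2 + μ * p.1}.indicator
            (fun p => ENNReal.ofReal (stableHalfDensity p.1 (p.2 + μ * p.1))) := by
        ext p
        simp [indicator]
      rw [this]
      refine Measurable.indicator ?_ (measurableSet_lt measurable_const (by fun_prop))
      exact (measurable_stableHalfDensity.comp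
        (by fun_prop : Measurable fun p : ℝ × ℝ => (p.1, p.2 + μ * p.1))).ennreal_ofReal
    simp only [hk, Function.uncurry_def]
    fun_prop
  simp_rw [hstep]
  rw [lintegral_lintegral_swap hkm.aemeasurable, ← lintegral_indicator measurableSet_Iio]
  have hae : ∀ᵐ z : ℝ, z ≠ 0 := by
    simp [ae_iff]
  refine lintegral_congr_ae ?_
  filter_upwards [hae] with z hz
  rcases lt_or_gt_of_ne hz with hz | hz
  · rw [indicator_of_mem (by exact hz), ← lintegral_potential_density hμ hw hrw hz]
    have hFz : F z = f z := indicator_of_mem (show z ∈ Iic (0 : ℝ) from hz.le) _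
    have hm : Measurable fun t => ENNReal.ofReal (exp (-r * t)) *
        ENNReal.ofReal (stableHalfDensity t (z + μ * t)) := by
      have := (measurable_stableHalfDensity.comp
        (by fun_prop : Measurable fun t : ℝ => (t, z + μ * t))).ennreal_ofReal
      simp only [Function.comp_def] at this
      fun_prop
    rw [← lintegral_mul_const _ hm, ← lintegral_indicator measurableSet_Ioi,
      ← lintegral_indicator measurableSet_Ioi]
    refine lintegral_congr fun t => ?_
    by_cases ht : -z / μ < t
    · have ht0 : 0 < t := lt_trans (div_pos (by linarith) hμ) ht
      have hzt : 0 < z + μ * t := by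
        rw [div_lt_iff₀ hμ] at ht; linarith
      rw [indicator_of_mem (by exact ht0), indicator_of_mem (by exact ht)]
      simp only [hk]
      rw [indicator_of_mem (by exact hzt), hFz, mul_assoc]
    · have hzt : ¬ 0 < z + μ * t := by
        intro h
        apply ht
        rw [div_lt_iff₀ hμ]; linarith
      rw [indicator_of_notMem (s := Ioi (-z / μ)) (by exact ht)]
      simp only [indicator, hk]
      simp [hzt]
  · have hFz : F z = 0 := indicator_of_notMem (by simpa using hz) _
    rw [indicator_of_notMem (by simpa using hz.le)]
    simp [hk, hFz]

instance (μ r : ℝ) : SFinite (potential μ r) := by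
  unfold potential; infer_instance

lemma lintegral_Iic_exp {c : ℝ} (hc : 0 < c) (x : ℝ) :
    ∫⁻ z in Iic x, ENNReal.ofReal (exp (c * z)) = ENNReal.ofReal (exp (c * x) / c) := by
  rw [← ofReal_integral_eq_lintegral_ofReal (integrableOn_exp_mul_Iic hc x)
    (ae_of_all _ fun x => (exp_pos _).le), integral_exp_mul_Iic hc]

lemma setLIntegral_Iic_exp_potential {μ r w θ x : ℝ} (hμ : 0 < μ) (hw : 1 < 2 * μ * w)
    (hrw : μ * w ^ 2 - w = r) (hθ : θ < w ^ 2) (hx : x < 0) :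
    ∫⁻ z in Iic x, ENNReal.ofReal (exp (-θ * z)) ∂(potential μ r) =
      ENNReal.ofReal (2 * w / (2 * μ * w - 1) * (exp ((w ^ 2 - θ) * x) / (w ^ 2 - θ))) := by
  have hw0 : 0 < w := by
    by_contra h
    have : 2 * μ * w ≤ 0 := mul_nonpos_of_nonneg_of_nonpos (by linarith) (not_lt.1 h)
    linarith
  have hc : 0 ≤ 2 * w / (2 * μ * w - 1) := div_nonneg (by linarith) (by linarith)
  have h1 : ∫⁻ z in Iic x, ENNReal.ofReal (exp (-θ * z)) ∂(potential μ r) =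
      ∫⁻ z in Iic 0, (Iic x).indicator (fun z => ENNReal.ofReal (exp (-θ * z))) z
        ∂(potential μ r) := by
    rw [lintegral_indicator measurableSet_Iic, Measure.restrict_restrict measurableSet_Iic,
      Iic_inter_Iic, min_eq_left hx.le]
  have hm : Measurable ((Iic x).indicator fun z => ENNReal.ofReal (exp (-θ * z))) :=
    Measurable.indicator (by fun_prop) measurableSet_Iic
  rw [h1, setLIntegral_Iic_potential hμ hw hrw hm, ENNReal.ofReal_mul hc,
    ← lintegral_Iic_exp (sub_pos.2 hθ) x, ← lintegral_const_mul' _ _ ENNReal.ofReal_ne_top,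
    ← lintegral_indicator measurableSet_Iic, ← lintegral_indicator measurableSet_Iio]
  refine lintegral_congr fun z => ?_
  by_cases hz : z ≤ x
  · have hz0 : z < 0 := by linarith
    simp only [indicator, mem_Iio, mem_Iic, hz, hz0, if_true]
    rw [← ENNReal.ofReal_mul (by positivity), ← ENNReal.ofReal_mul hc, mul_assoc, ← exp_add]
    ring_nf
  · simp [indicator, hz]

/-- The exponential law on the negative half-line solves the sojourn renewal equation. -/
lemma exp_renewal {μ q lam w₀ w : ℝ} (hμ : 0 < μ) (hlam : 0 < lam)
    (hw₀ : 1 < 2 * μ * w₀) (hw : 1 < 2 * μ * w) (hlt : w₀ < w)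
    (hqw : μ * w₀ ^ 2 - w₀ = q) (hrw : μ * w ^ 2 - w = q + lam)
    {f : ℝ → ℝ≥0∞} (hf : Measurable f) :
    ∫⁻ x in Iio (0 : ℝ), ENNReal.ofReal ((w ^ 2 - w₀ ^ 2) / lam * exp (w₀ ^ 2 * x)) * f x =
      ∫⁻ z in Iic 0, f z ∂(potential μ (q + lam)) + ENNReal.ofReal lam *
        ∫⁻ y in Iio (0 : ℝ), ENNReal.ofReal ((w ^ 2 - w₀ ^ 2) / lam * exp (w₀ ^ 2 * y)) *
          ∫⁻ z, (Iic (0 : ℝ)).indicator f (y + z) ∂(potential μ (q + lam)) := by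
  have hw0 : 0 < w₀ := by
    by_contra h
    have : 2 * μ * w₀ ≤ 0 := mul_nonpos_of_nonneg_of_nonpos (by linarith) (not_lt.1 h)
    linarith
  have hgap : 0 < w ^ 2 - w₀ ^ 2 := by nlinarith
  set K := (w ^ 2 - w₀ ^ 2) / lam with hK
  have hK0 : 0 < K := by positivity
  set V := potential μ (q + lam) with hV
  set F := (Iic (0 : ℝ)).indicator f with hF
  have hFm : Measurable F := hf.indicator measurableSet_Iic
  set c : ℝ → ℝ≥0∞ := fun y => ENNReal.ofReal (K * exp (w₀ ^ 2 * y)) with hc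
  have hcm : Measurable c := by rw [hc]; fun_prop
  have hswap : ∫⁻ y in Iio (0 : ℝ), c y * ∫⁻ z, F (y + z) ∂V =
      ∫⁻ x in Iio (0 : ℝ), (c x * ∫⁻ z in Ioi x, ENNReal.ofReal (exp (-w₀ ^ 2 * z)) ∂V) * f x := by
    have h1 : ∫⁻ y in Iio (0 : ℝ), c y * ∫⁻ z, F (y + z) ∂V =
        ∫⁻ y, ∫⁻ z, (Iio (0 : ℝ)).indicator c y * F (y + z) ∂V := by
      rw [← lintegral_indicator measurableSet_Iio]
      refine lintegral_congr fun y => ?_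
      rw [lintegral_const_mul _ (by fun_prop)]
      by_cases hy : y < 0 <;> simp [indicator, hy]
    have hcim : Measurable ((Iio (0 : ℝ)).indicator c) := hcm.indicator measurableSet_Iio
    have h2 : ∀ z, ∫⁻ y, (Iio (0 : ℝ)).indicator c y * F (y + z) =
        ∫⁻ x, (Iio (0 : ℝ)).indicator c (x - z) * F x := by
      intro z
      rw [← lintegral_sub_right_eq_self _ z]
      simp
    rw [h1, lintegral_lintegral_swap (by fun_prop)]
    simp_rw [h2]
    rw [lintegral_lintegral_swap (by fun_prop), ← lintegral_indicator measurableSet_Iio]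
    have hae : ∀ᵐ x : ℝ, x ≠ 0 := by simp [ae_iff]
    refine lintegral_congr_ae ?_
    filter_upwards [hae] with x hx
    rw [lintegral_mul_const _ (by fun_prop)]
    rcases lt_or_gt_of_ne hx with hx | hx
    · rw [indicator_of_mem (by exact hx), hF, indicator_of_mem (by exact hx.le)]
      congr 1
      rw [← lintegral_const_mul' _ _ ENNReal.ofReal_ne_top, ← lintegral_indicator measurableSet_Ioi]
      refine lintegral_congr fun z => ?_
      by_cases hz : x < z
      · simp only [indicator, mem_Iio, mem_Ioi, sub_neg, hz, if_true, hc]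
        rw [← ENNReal.ofReal_mul (by positivity), mul_assoc, ← exp_add]
        ring_nf
      · simp [indicator, hz]
    · simp [hF, indicator, hx.le, hx]
  rw [hswap, setLIntegral_Iic_potential hμ hw hrw hf,
    ← lintegral_const_mul' _ _ ENNReal.ofReal_ne_top]
  have hmeas : Measurable fun z =>
      ENNReal.ofReal (2 * w / (2 * μ * w - 1) * exp (w ^ 2 * z)) * f z := by fun_prop
  rw [← lintegral_add_left hmeas]
  refine setLIntegral_congr_fun measurableSet_Iio fun x hx => ?_
  have hx' : x < 0 := hx
  rw [← mul_assoc, ← add_mul]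
  congr 1
  have hθ : w₀ ^ 2 < w ^ 2 := by linarith
  have htot : ∫⁻ z in Iic x, ENNReal.ofReal (exp (-w₀ ^ 2 * z)) ∂V +
      ∫⁻ z in Ioi x, ENNReal.ofReal (exp (-w₀ ^ 2 * z)) ∂V = ENNReal.ofReal (1 / lam) := by
    rw [← compl_Iic, lintegral_add_compl _ measurableSet_Iic, hV,
      lintegral_exp_potential (by positivity) (by rw [sqrt_sq hw0.le]; linarith), sqrt_sq hw0.le,
      hqw]
    congr 2; ring
  have hd : 0 < 2 * μ * w - 1 := by linarith
  have hww : 0 < w := by linarith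
  have hH : ENNReal.ofReal (2 * w / (2 * μ * w - 1) * exp (w ^ 2 * x)) =
      ENNReal.ofReal lam * (c x * ∫⁻ z in Iic x, ENNReal.ofReal (exp (-w₀ ^ 2 * z)) ∂V) := by
    rw [setLIntegral_Iic_exp_potential hμ hw hrw hθ hx', hc]
    simp only
    rw [← ENNReal.ofReal_mul (by positivity), ← ENNReal.ofReal_mul hlam.le]
    congr 1
    have : exp (w ^ 2 * x) = exp (w₀ ^ 2 * x) * exp ((w ^ 2 - w₀ ^ 2) * x) := by
      rw [← exp_add]; congr 1; ring
    rw [this, hK]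
    field_simp
  rw [hH, ← mul_add, ← mul_add, htot, hc]
  simp only
  rw [← ENNReal.ofReal_mul (by positivity), ← ENNReal.ofReal_mul hlam.le]
  congr 1
  field_simp

lemma le_of_contracting_renewal {N e v : (ℝ → ℝ≥0∞) → ℝ≥0∞} {T : (ℝ → ℝ≥0∞) → ℝ → ℝ≥0∞}
    {l m M : ℝ≥0∞} (hlm : l * m < 1) (hM : M ≠ ⊤)
    (hT : ∀ f, Measurable f → Measurable (T f))
    (hTb : ∀ f c, Measurable f → (∀ x, f x ≤ c) → ∀ x, T f x ≤ m * c)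
    (hN : ∀ f, Measurable f → N f = v f + l * N (T f))
    (he : ∀ f, Measurable f → e f = v f + l * e (T f))
    (hNb : ∀ f c, Measurable f → (∀ x, f x ≤ c) → N f ≤ M * c)
    {f : ℝ → ℝ≥0∞} (hf : Measurable f) (hf1 : ∀ x, f x ≤ 1) : N f ≤ e f := by
  have key : ∀ (n : ℕ) (f : ℝ → ℝ≥0∞) (c : ℝ≥0∞), Measurable f → (∀ x, f x ≤ c) →
      N f ≤ e f + (l * m) ^ n * (M * c) := by
    intro n
    induction n with
    | zero =>
      intro f c hf hc
      simpa using le_add_left (hNb f c hf hc)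
    | succ n ih =>
      intro f c hf hc
      rw [hN f hf, he f hf, add_assoc]
      gcongr
      calc l * N (T f) ≤ l * (e (T f) + (l * m) ^ n * (M * (m * c))) := by
            gcongr
            exact ih _ _ (hT f hf) (hTb f c hf hc)
        _ = l * e (T f) + (l * m) ^ (n + 1) * (M * c) := by ring
  have hlim : Tendsto (fun n : ℕ => e f + (l * m) ^ n * (M * 1)) atTop (𝓝 (e f + 0 * (M * 1))) := by
    refine tendsto_const_nhds.add (ENNReal.Tendsto.mul_const
      (ENNReal.tendsto_pow_atTop_nhds_zero_of_lt_one hlm) (Or.inr ?_))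
    simpa using hM
  rw [zero_mul, add_zero] at hlim
  exact ge_of_tendsto' hlim fun n => key n f 1 hf hf1

lemma intervalIntegrable_indicator_one {U : Set ℝ} (hU : MeasurableSet U) (a b : ℝ) :
    IntervalIntegrable (U.indicator (1 : ℝ → ℝ)) volume a b := by
  refine (intervalIntegrable_const (c := (1 : ℝ))).mono_fun
    ((measurable_one.indicator hU).aestronglyMeasurable) (ae_of_all _ fun x => ?_)
  by_cases h : x ∈ U <;> simp [h]

lemma lipschitzWith_sojourn {U : Set ℝ} (hU : MeasurableSet U) :
    LipschitzWith 1 fun t => ∫ s in (0 : ℝ)..t, U.indicator (1 : ℝ → ℝ) s := by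
  refine LipschitzWith.of_dist_le_mul fun x y => ?_
  rw [dist_eq_norm, intervalIntegral.integral_interval_sub_left
    (intervalIntegrable_indicator_one hU _ _) (intervalIntegrable_indicator_one hU _ _)]
  refine (intervalIntegral.norm_integral_le_of_norm_le_const (C := 1) fun s _ => ?_).trans ?_
  · by_cases h : s ∈ U <;> simp [h]
  · simp [Real.dist_eq]

lemma exp_sojourn_eq {U : Set ℝ} (hU : MeasurableSet U) {lam : ℝ} (hlam : 0 ≤ lam) {t : ℝ}
    (ht : 0 ≤ t) :
    ENNReal.ofReal (exp (lam * ∫ s in (0 : ℝ)..t, U.indicator (1 : ℝ → ℝ) s)) =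
      1 + ENNReal.ofReal lam * ∫⁻ s in Ioc 0 t, U.indicator 1 s *
        ENNReal.ofReal (exp (lam * ∫ u in (0 : ℝ)..s, U.indicator (1 : ℝ → ℝ) u)) := by
  set I : ℝ → ℝ := fun t => ∫ s in (0 : ℝ)..t, U.indicator (1 : ℝ → ℝ) s with hI
  have hIl : LipschitzWith 1 I := lipschitzWith_sojourn hU
  have hexp : ContDiff ℝ 1 fun x : ℝ => exp (lam * x) := by fun_prop
  have hl : LocallyLipschitz fun t => exp (lam * I t) :=
    hexp.locallyLipschitz.comp hIl.locallyLipschitz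
  obtain ⟨K, hK⟩ := (hl.locallyLipschitzOn (s := uIcc 0 t)).exists_lipschitzOnWith_of_compact
    isCompact_uIcc
  have hftc := hK.absolutelyContinuousOnInterval.integral_deriv_eq_sub
  have hder : ∀ᵐ s, s ∈ uIoc 0 t → deriv (fun t => exp (lam * I t)) s =
      lam * (U.indicator 1 s * exp (lam * I s)) := by
    filter_upwards [(intervalIntegrable_indicator_one hU 0 t).ae_hasDerivAt_integral] with s hs hst
    have := ((hs (uIoc_subset_uIcc hst) 0 left_mem_uIcc).const_mul lam).exp.deriv
    rw [this]; ring
  rw [intervalIntegral.integral_congr_ae hder, intervalIntegral.integral_const_mul,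
    intervalIntegral.integral_of_le ht] at hftc
  have hI0 : I 0 = 0 := by simp [hI]
  have hnn : ∀ s, 0 ≤ U.indicator (1 : ℝ → ℝ) s * exp (lam * I s) := fun s =>
    mul_nonneg (indicator_nonneg (fun _ _ => zero_le_one) s) (exp_pos _).le
  have hint : IntegrableOn (fun s => U.indicator (1 : ℝ → ℝ) s * exp (lam * I s)) (Ioc 0 t) :=
    ((intervalIntegrable_indicator_one hU 0 t).mul_continuousOn
      hl.continuous.continuousOn).1
  have hlin : ∫⁻ s in Ioc 0 t, U.indicator 1 s * ENNReal.ofReal (exp (lam * I s)) =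
      ENNReal.ofReal (∫ s in Ioc 0 t, U.indicator (1 : ℝ → ℝ) s * exp (lam * I s)) := by
    rw [ofReal_integral_eq_lintegral_ofReal hint (ae_of_all _ hnn)]
    refine lintegral_congr fun s => ?_
    by_cases h : s ∈ U <;> simp [h]
  rw [hlin, ← ENNReal.ofReal_mul hlam, ← ENNReal.ofReal_one,
    ← ENNReal.ofReal_add zero_le_one (mul_nonneg hlam (integral_nonneg hnn)), hftc, hI0]
  simp [hI]

/-- The time up to `t` that the path `x` spends below the line `u ↦ μ * u`. -/
def timeBelow (μ : ℝ) (x : ℝ → ℝ) (t : ℝ) : ℝ :=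
  ∫ u in (0 : ℝ)..t, {u | x u ≤ μ * u}.indicator (1 : ℝ → ℝ) u

lemma measurable_timeBelow {E : Type*} [MeasurableSpace E] (μ : ℝ) {Z : ℝ × E → ℝ}
    (hZ : Measurable Z) :
    Measurable fun p : ℝ × E => timeBelow μ (fun u => Z (u, p.2)) p.1 := by
  unfold timeBelow
  simp_rw [intervalIntegral.intervalIntegral_eq_integral_uIoc, smul_eq_mul]
  have hle : MeasurableSet {p : ℝ × E | (0 : ℝ) ≤ p.1} :=
    measurableSet_le measurable_const measurable_fst
  refine Measurable.mul (Measurable.ite hle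
    measurable_const measurable_const) ?_
  simp_rw [← integral_indicator measurableSet_uIoc]
  refine (StronglyMeasurable.integral_prod_right' (ν := volume)
    (f := fun z : (ℝ × E) × ℝ => (uIoc 0 z.1.1).indicator
      ({u | Z (u, z.1.2) ≤ μ * u}.indicator 1) z.2) ?_).measurable
  refine Measurable.stronglyMeasurable ?_
  have : (fun z : (ℝ × E) × ℝ => (uIoc 0 z.1.1).indicator
      ({u | Z (u, z.1.2) ≤ μ * u}.indicator (1 : ℝ → ℝ)) z.2) =
      ({z : (ℝ × E) × ℝ | min 0 z.1.1 < z.2} ∩ {z | z.2 ≤ max 0 z.1.1}).indicator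
        ({z : (ℝ × E) × ℝ | Z (z.2, z.1.2) ≤ μ * z.2}.indicator 1) := by
    ext z
    simp [indicator, uIoc]
  rw [this]
  refine (measurable_one.indicator (measurableSet_le (hZ.comp (by fun_prop)) (by fun_prop))).indicator
    ((measurableSet_lt (by fun_prop) (by fun_prop)).inter
      (measurableSet_le (by fun_prop) (by fun_prop)))

/-- The exponential of `lam` times the time spent below the line, on the event of being below. -/
def belowWeight (μ lam : ℝ) (x : ℝ → ℝ) (t : ℝ) : ℝ≥0∞ :=
  (Iic (0 : ℝ)).indicator 1 (x t - μ * t) * ENNReal.ofReal (exp (lam * timeBelow μ x t))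

lemma measurable_belowWeight {E : Type*} [MeasurableSpace E] (μ lam : ℝ) {Z : ℝ × E → ℝ}
    (hZ : Measurable Z) :
    Measurable fun p : ℝ × E => belowWeight μ lam (fun u => Z (u, p.2)) p.1 := by
  unfold belowWeight
  refine ((measurable_one.indicator measurableSet_Iic).comp (by fun_prop)).mul ?_
  exact ((measurable_timeBelow μ hZ).const_mul lam).exp.ennreal_ofReal

lemma timeBelow_congr {μ t : ℝ} {x y : ℝ → ℝ} (ht : 0 ≤ t) (h : ∀ u ∈ Ioc 0 t, x u = y u) :
    timeBelow μ x t = timeBelow μ y t := by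
  unfold timeBelow
  refine intervalIntegral.integral_congr_ae (ae_of_all _ fun u hu => ?_)
  rw [uIoc_of_le ht] at hu
  simp [indicator, h u hu]

lemma timeBelow_le {μ t : ℝ} (x : ℝ → ℝ) (ht : 0 ≤ t) : timeBelow μ x t ≤ t := by
  unfold timeBelow
  refine (Real.le_norm_self _).trans
    ((intervalIntegral.norm_integral_le_of_norm_le_const (C := 1) fun s _ => ?_).trans ?_)
  · by_cases h : x s ≤ μ * s <;> simp [h]
  · simp [abs_of_nonneg ht]

/-- The law at time `t` of a standard `1/2`-stable subordinator. -/
def stableHalfLaw (t : ℝ) : Measure ℝ :=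
  (volume.restrict (Ioi 0)).withDensity fun x => ENNReal.ofReal (stableHalfDensity t x)

lemma measurable_ofReal_stableHalfDensity (t : ℝ) :
    Measurable fun x => ENNReal.ofReal (stableHalfDensity t x) :=
  (measurable_stableHalfDensity.comp (by fun_prop : Measurable fun x : ℝ => (t, x))).ennreal_ofReal

lemma lintegral_stableHalfLaw (t : ℝ) {f : ℝ → ℝ≥0∞} (hf : Measurable f) :
    ∫⁻ x, f x ∂(stableHalfLaw t) =
      ∫⁻ x in Ioi 0, ENNReal.ofReal (stableHalfDensity t x) * f x := by
  unfold stableHalfLaw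
  rw [lintegral_withDensity_eq_lintegral_mul _ (measurable_ofReal_stableHalfDensity t) hf]
  rfl

lemma isProbabilityMeasure_stableHalfLaw {t : ℝ} (ht : 0 < t) :
    IsProbabilityMeasure (stableHalfLaw t) := by
  refine ⟨?_⟩
  rw [← lintegral_one, lintegral_stableHalfLaw t measurable_const]
  simpa using lintegral_stableHalfDensity ht

/-- `S` starts at `0`, is progressively measurable for `𝓖`, and its increments after time `s`
are independent of `𝓖 s` with the `1/2`-stable law. -/
structure IsStableHalfProcess {Ω : Type*} [mΩ : MeasurableSpace Ω] (P : Measure Ω)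
    (S : ℝ → Ω → ℝ) (𝓖 : ℝ → MeasurableSpace Ω) : Prop where
  zero : ∀ ω, S 0 ω = 0
  measurable : Measurable fun p : ℝ × Ω => S p.1 p.2
  le : ∀ s, 𝓖 s ≤ mΩ
  prog : ∀ s, 0 ≤ s → @Measurable (ℝ × Ω) ℝ (@Prod.instMeasurableSpace ℝ Ω _ (𝓖 s)) _
    fun p => S (min p.1 s) p.2
  map_increment : ∀ s t, 0 ≤ s → s < t → ∀ A, MeasurableSet[𝓖 s] A →
    (P.restrict A).map (fun ω => S t ω - S s ω) = P A • stableHalfLaw (t - s)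

lemma lintegral_prod_of_map_restrict {Ω E : Type*} [MeasurableSpace Ω] [MeasurableSpace E]
    {P : Measure Ω} [IsFiniteMeasure P] {W : Ω → E} {ξ : Ω → ℝ} {ν : Measure ℝ} [SigmaFinite ν]
    (hW : Measurable W) (hξ : Measurable ξ)
    (h : ∀ A, MeasurableSet A → (P.restrict (W ⁻¹' A)).map ξ = P (W ⁻¹' A) • ν)
    {F : E × ℝ → ℝ≥0∞} (hF : Measurable F) :
    ∫⁻ ω, F (W ω, ξ ω) ∂P = ∫⁻ ω, ∫⁻ x, F (W ω, x) ∂ν ∂P := by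
  have hprod : (P.map W).prod ν = P.map fun ω => (W ω, ξ ω) := by
    refine Measure.prod_eq fun A C hA hC => ?_
    rw [Measure.map_apply (by fun_prop) (hA.prod hC), Measure.map_apply hW hA]
    have := congrArg (fun m => m C) (h A hA)
    simp only [Measure.map_apply hξ hC, Measure.restrict_apply (hξ hC), Measure.smul_apply,
      smul_eq_mul] at this
    rw [← this]
    congr 1
    ext ω
    simp [and_comm]
  rw [← lintegral_map hF (by fun_prop : Measurable fun ω => (W ω, ξ ω)), ← hprod,
    lintegral_prod _ hF.aemeasurable, lintegral_map hF.lintegral_prod_right' hW]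

namespace IsStableHalfProcess

variable {Ω : Type*} [mΩ : MeasurableSpace Ω] {P : Measure Ω} {S : ℝ → Ω → ℝ}
  {𝓖 : ℝ → MeasurableSpace Ω}

lemma measurable_apply (hS : IsStableHalfProcess P S 𝓖) (t : ℝ) : Measurable (S t) :=
  hS.measurable.comp (by fun_prop : Measurable fun ω : Ω => (t, ω))

lemma measurable_adapted (hS : IsStableHalfProcess P S 𝓖) {s : ℝ} (hs : 0 ≤ s) :
    Measurable[𝓖 s] (S s) := by
  simpa [Function.comp_def] using
    (hS.prog s hs).comp (@measurable_prodMk_left ℝ Ω _ (𝓖 s) s)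

lemma measurable_belowWeight_adapted (hS : IsStableHalfProcess P S 𝓖) (μ lam : ℝ) {s : ℝ}
    (hs : 0 ≤ s) : Measurable[𝓖 s] fun ω => belowWeight μ lam (fun u => S u ω) s := by
  have := (@measurable_belowWeight Ω (𝓖 s) μ lam _ (hS.prog s hs)).comp
    (@measurable_prodMk_left ℝ Ω _ (𝓖 s) s)
  convert this using 2 with ω
  simp only [belowWeight, Function.comp_apply, min_self]
  rw [timeBelow_congr (y := fun u => S (min u s) ω) hs fun u hu => by rw [min_eq_left hu.2]]

lemma lintegral_increment [IsFiniteMeasure P] (hS : IsStableHalfProcess P S 𝓖) {s t : ℝ}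
    (hs : 0 ≤ s) (hst : s < t) {G : Ω → ℝ≥0∞} {Y : Ω → ℝ} (hG : Measurable[𝓖 s] G)
    (hY : Measurable[𝓖 s] Y) {f : ℝ → ℝ≥0∞} (hf : Measurable f) :
    ∫⁻ ω, G ω * f (Y ω + (S t ω - S s ω)) ∂P =
      ∫⁻ ω, G ω * (∫⁻ x in Ioi 0,
        ENNReal.ofReal (stableHalfDensity (t - s) x) * f (Y ω + x)) ∂P := by
  have := isProbabilityMeasure_stableHalfLaw (sub_pos.2 hst)
  have hWm : Measurable[𝓖 s] fun ω => (G ω, Y ω) := hG.prodMk hY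
  have h := lintegral_prod_of_map_restrict (P := P) (W := fun ω => (G ω, Y ω))
    (ξ := fun ω => S t ω - S s ω) (ν := stableHalfLaw (t - s))
    (F := fun p : (ℝ≥0∞ × ℝ) × ℝ => p.1.1 * f (p.1.2 + p.2))
    (hWm.mono (hS.le s) le_rfl) ((hS.measurable_apply t).sub (hS.measurable_apply s))
    (fun A hA => hS.map_increment s t hs hst _ (hWm hA)) (by fun_prop)
  simp only at h
  rw [h]
  refine lintegral_congr fun ω => ?_
  have hfm : Measurable fun x => f (Y ω + x) := hf.comp (by fun_prop)
  rw [lintegral_const_mul _ hfm, lintegral_stableHalfLaw _ hfm]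

lemma lintegral_apply [IsProbabilityMeasure P] (hS : IsStableHalfProcess P S 𝓖) {t : ℝ}
    (ht : 0 < t) {f : ℝ → ℝ≥0∞} (hf : Measurable f) :
    ∫⁻ ω, f (S t ω) ∂P = ∫⁻ x in Ioi 0, ENNReal.ofReal (stableHalfDensity t x) * f x := by
  have := hS.lintegral_increment le_rfl ht (G := fun _ => 1) (Y := fun _ => 0)
    measurable_const measurable_const hf
  simpa [hS.zero] using this

/-- The resolvent of `S t - μ * t` weighted by the exponential of the time spent below `0`. -/
def weightedResolvent (P : Measure Ω) (S : ℝ → Ω → ℝ) (μ r lam : ℝ) (f : ℝ → ℝ≥0∞) : ℝ≥0∞ :=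
  ∫⁻ t in Ioi (0 : ℝ), ENNReal.ofReal (exp (-r * t)) *
    ∫⁻ ω, ENNReal.ofReal (exp (lam * timeBelow μ (fun u => S u ω) t)) * f (S t ω - μ * t) ∂P

set_option maxHeartbeats 1000000 in
lemma weightedResolvent_eq [IsProbabilityMeasure P] (hS : IsStableHalfProcess P S 𝓖)
    (μ r : ℝ) {lam : ℝ} (hlam : 0 ≤ lam) {f : ℝ → ℝ≥0∞} (hf : Measurable f) :
    weightedResolvent P S μ r lam f = ∫⁻ z, f z ∂(potential μ r) + ENNReal.ofReal lam *
      weightedResolvent P S μ r lam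
        ((Iic 0).indicator fun y => ∫⁻ z, f (y + z) ∂(potential μ r)) := by
  have hSm := hS.measurable
  -- the integrand after expanding the exponential of the occupation time
  set H : ℝ × Ω → ℝ≥0∞ := fun p => belowWeight μ lam (fun u => S u p.2) p.1 with hH
  have hHm : Measurable H := measurable_belowWeight μ lam hSm
  have hexpand : ∀ t ∈ Ioi (0 : ℝ), ∀ ω,
      ENNReal.ofReal (exp (lam * timeBelow μ (fun u => S u ω) t)) =
        1 + ENNReal.ofReal lam * ∫⁻ s in Ioi 0, (Ioi s).indicator 1 t * H (s, ω) := by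
    intro t ht ω
    have hU : MeasurableSet {u | S u ω ≤ μ * u} :=
      measurableSet_le (hSm.comp (by fun_prop : Measurable fun u : ℝ => (u, ω))) (by fun_prop)
    have := exp_sojourn_eq hU hlam (le_of_lt ht)
    unfold timeBelow
    rw [this]
    congr 2
    rw [setLIntegral_congr Ioo_ae_eq_Ioc.symm, ← lintegral_indicator measurableSet_Ioo,
      ← lintegral_indicator measurableSet_Ioi]
    refine lintegral_congr fun s => ?_
    by_cases h0 : 0 < s <;> by_cases hst : s < t <;>
      simp [indicator, h0, hst, hH, belowWeight, timeBelow]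
  set k : ℝ → ℝ → ℝ≥0∞ := fun t y =>
    ∫⁻ x in Ioi 0, ENNReal.ofReal (stableHalfDensity t x) * f (y + x) with hk
  have hkm : Measurable fun p : ℝ × ℝ => k p.1 p.2 := by
    refine Measurable.lintegral_prod_right' (f := fun z : (ℝ × ℝ) × ℝ =>
      ENNReal.ofReal (stableHalfDensity z.1.1 z.2) * f (z.1.2 + z.2)) ?_
    exact (measurable_stableHalfDensity.comp
      (by fun_prop : Measurable fun z : (ℝ × ℝ) × ℝ => (z.1.1, z.2))).ennreal_ofReal.mul
        (hf.comp (by fun_prop))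
  -- the Markov property at time `s`
  have hmarkov : ∀ s, 0 < s → ∀ t, s < t → ∫⁻ ω, H (s, ω) * f (S t ω - μ * t) ∂P =
      ∫⁻ ω, H (s, ω) * k (t - s) (S s ω - μ * t) ∂P := by
    intro s hs t hst
    rw [← hS.lintegral_increment hs.le hst (hS.measurable_belowWeight_adapted μ lam hs.le)
      ((hS.measurable_adapted hs.le).sub_const (μ * t)) hf]
    refine lintegral_congr fun ω => ?_
    rw [show S s ω - μ * t + (S t ω - S s ω) = S t ω - μ * t by ring]
  -- integrating over the time elapsed since `s`
  have hpot : ∀ s, 0 < s → ∀ ω, ∫⁻ t in Ioi 0, (Ioi s).indicator 1 t *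
      (ENNReal.ofReal (exp (-r * t)) * k (t - s) (S s ω - μ * t)) =
      ENNReal.ofReal (exp (-r * s)) * ∫⁻ z, f (S s ω - μ * s + z) ∂(potential μ r) := by
    intro s hs ω
    rw [lintegral_potential μ r (f := fun z => f (S s ω - μ * s + z)) (hf.comp (by fun_prop)),
      ← lintegral_const_mul' _ _ ENNReal.ofReal_ne_top, ← lintegral_indicator measurableSet_Ioi,
      ← lintegral_indicator measurableSet_Ioi, ← lintegral_add_right_eq_self _ s]
    refine lintegral_congr fun t => ?_
    by_cases ht : 0 < t
    · have hts : 0 < t + s := by positivity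
      simp only [indicator, mem_Ioi, ht, hts, lt_add_iff_pos_left, if_true, hk, Pi.one_apply,
        one_mul, add_sub_cancel_right]
      rw [← mul_assoc, ← ENNReal.ofReal_mul (exp_pos _).le, ← exp_add]
      ring_nf
    · simp [indicator, ht]
  have hfX : Measurable fun p : ℝ × Ω => f (S p.1 p.2 - μ * p.1) := hf.comp (by fun_prop)
  have hind : Measurable fun p : ℝ × ℝ => (Ioi p.2).indicator (1 : ℝ → ℝ≥0∞) p.1 :=
    measurable_one.indicator (measurableSet_lt measurable_snd measurable_fst)
  have hfXt : ∀ t, Measurable fun ω => f (S t ω - μ * t) := fun t =>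
    hfX.comp (by fun_prop : Measurable fun ω => (t, ω))
  have hsplit : ∀ t ∈ Ioi (0 : ℝ), ENNReal.ofReal (exp (-r * t)) *
      ∫⁻ ω, ENNReal.ofReal (exp (lam * timeBelow μ (fun u => S u ω) t)) * f (S t ω - μ * t) ∂P =
      ENNReal.ofReal (exp (-r * t)) * (∫⁻ x in Ioi 0, ENNReal.ofReal (stableHalfDensity t x) *
        f (x - μ * t)) + ENNReal.ofReal lam * ∫⁻ s in Ioi 0, (Ioi s).indicator 1 t *
          (ENNReal.ofReal (exp (-r * t)) * ∫⁻ ω, H (s, ω) * k (t - s) (S s ω - μ * t) ∂P) := by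
    intro t ht
    have hft : Measurable fun x => f (x - μ * t) := hf.comp (by fun_prop)
    rw [← hS.lintegral_apply ht hft]
    have h1 : ∀ ω, ENNReal.ofReal (exp (lam * timeBelow μ (fun u => S u ω) t)) *
        f (S t ω - μ * t) = f (S t ω - μ * t) + ENNReal.ofReal lam *
          ∫⁻ s in Ioi 0, (Ioi s).indicator 1 t * (H (s, ω) * f (S t ω - μ * t)) := by
      intro ω
      rw [hexpand t ht ω, add_mul, one_mul, mul_assoc, ← lintegral_mul_const]
      · simp_rw [mul_assoc]
      · exact (hind.comp (by fun_prop : Measurable fun s : ℝ => (t, s))).mul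
          (hHm.comp (by fun_prop))
    have hjm : Measurable fun p : Ω × ℝ => (Ioi p.2).indicator 1 t *
        (H (p.2, p.1) * f (S t p.1 - μ * t)) :=
      (hind.comp (by fun_prop : Measurable fun p : Ω × ℝ => (t, p.2))).mul
        ((hHm.comp (by fun_prop)).mul ((hfXt t).comp measurable_fst))
    simp_rw [h1]
    rw [lintegral_add_left (hfXt t), mul_add, lintegral_const_mul' _ _ ENNReal.ofReal_ne_top,
      lintegral_lintegral_swap hjm.aemeasurable, mul_left_comm]
    congr 2
    rw [← lintegral_const_mul' _ _ ENNReal.ofReal_ne_top]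
    refine setLIntegral_congr_fun measurableSet_Ioi fun s hs => ?_
    by_cases hst : s < t
    · simp [indicator, hst, hmarkov s hs t hst]
    · simp [indicator, hst]
  have hkS : Measurable fun p : (ℝ × ℝ) × Ω => k (p.1.1 - p.1.2) (S p.1.2 p.2 - μ * p.1.1) :=
    hkm.comp (f := fun p : (ℝ × ℝ) × Ω => (p.1.1 - p.1.2, S p.1.2 p.2 - μ * p.1.1)) (by fun_prop)
  have hHk : Measurable fun p : (ℝ × ℝ) × Ω => H (p.1.2, p.2) *
      k (p.1.1 - p.1.2) (S p.1.2 p.2 - μ * p.1.1) := (hHm.comp (by fun_prop)).mul hkS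
  unfold weightedResolvent
  rw [setLIntegral_congr_fun measurableSet_Ioi hsplit, lintegral_potential μ r hf,
    lintegral_add_left, lintegral_const_mul' _ _ ENNReal.ofReal_ne_top,
    lintegral_lintegral_swap]
  · congr 2
    refine setLIntegral_congr_fun measurableSet_Ioi fun s hs => ?_
    have hm' : Measurable fun p : ℝ × Ω => (Ioi s).indicator 1 p.1 *
        (ENNReal.ofReal (exp (-r * p.1)) * (H (s, p.2) * k (p.1 - s) (S s p.2 - μ * p.1))) :=
      (hind.comp (by fun_prop : Measurable fun p : ℝ × Ω => (p.1, s))).mul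
        (Measurable.mul (by fun_prop)
          (hHk.comp (by fun_prop : Measurable fun p : ℝ × Ω => ((p.1, s), p.2))))
    calc _ = ∫⁻ t in Ioi 0, ∫⁻ ω, (Ioi s).indicator 1 t *
        (ENNReal.ofReal (exp (-r * t)) * (H (s, ω) * k (t - s) (S s ω - μ * t))) ∂P := by
          refine lintegral_congr fun t => ?_
          rw [lintegral_const_mul', lintegral_const_mul' _ _ ENNReal.ofReal_ne_top]
          by_cases h : s < t <;> simp [indicator, h]
      _ = ∫⁻ ω, H (s, ω) * (ENNReal.ofReal (exp (-r * s)) *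
            ∫⁻ z, f (S s ω - μ * s + z) ∂(potential μ r)) ∂P := by
          rw [lintegral_lintegral_swap hm'.aemeasurable]
          refine lintegral_congr fun ω => ?_
          rw [← hpot s hs ω, ← lintegral_const_mul]
          · refine lintegral_congr fun t => ?_
            rw [mul_left_comm _ (H _), mul_left_comm _ (H _)]
          · exact (hind.comp (by fun_prop : Measurable fun p : ℝ => (p, s))).mul
              (Measurable.mul (by fun_prop)
                (hkS.comp (by fun_prop : Measurable fun p : ℝ => ((p, s), ω))))
      _ = _ := by
          rw [← lintegral_const_mul' _ _ ENNReal.ofReal_ne_top]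
          refine lintegral_congr fun ω => ?_
          by_cases h : S s ω - μ * s ∈ Iic 0
          · simp only [hH, belowWeight, indicator_of_mem h, Pi.one_apply]
            ring
          · simp [hH, belowWeight, indicator_of_notMem h]
  · refine Measurable.aemeasurable ?_
    exact (hind.comp measurable_id).mul (Measurable.mul (by fun_prop) hHk.lintegral_prod_right')
  · refine Measurable.mul (by fun_prop) ?_
    refine Measurable.lintegral_prod_right' (f := fun z : ℝ × ℝ =>
      ENNReal.ofReal (stableHalfDensity z.1 z.2) * f (z.2 - μ * z.1)) ?_
    exact measurable_stableHalfDensity.ennreal_ofReal.mul (hf.comp (by fun_prop))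

lemma weightedResolvent_mono (P : Measure Ω) (S : ℝ → Ω → ℝ) (μ r lam : ℝ) {f g : ℝ → ℝ≥0∞}
    (hfg : ∀ x, f x ≤ g x) :
    weightedResolvent P S μ r lam f ≤ weightedResolvent P S μ r lam g := by
  unfold weightedResolvent
  gcongr
  exact hfg _

lemma weightedResolvent_const_le [IsProbabilityMeasure P] (S : ℝ → Ω → ℝ) (μ : ℝ) {q lam : ℝ}
    (hq : 0 < q) (hlam : 0 ≤ lam) (c : ℝ≥0∞) :
    weightedResolvent P S μ (q + lam) lam (fun _ => c) ≤ ENNReal.ofReal (1 / q) * c := by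
  have h : ∀ t ∈ Ioi (0 : ℝ), ENNReal.ofReal (exp (-(q + lam) * t)) *
      ∫⁻ ω, ENNReal.ofReal (exp (lam * timeBelow μ (fun u => S u ω) t)) * c ∂P ≤
      ENNReal.ofReal (exp (-q * t)) * c := by
    intro t ht
    calc _ ≤ ENNReal.ofReal (exp (-(q + lam) * t)) *
        ∫⁻ ω, ENNReal.ofReal (exp (lam * t)) * c ∂P := by
          gcongr
          exact timeBelow_le _ (le_of_lt ht)
      _ = _ := by
          rw [lintegral_const, measure_univ, mul_one, ← mul_assoc,
            ← ENNReal.ofReal_mul (exp_pos _).le, ← exp_add]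
          ring_nf
  unfold weightedResolvent
  refine (setLIntegral_mono' measurableSet_Ioi h).trans (le_of_eq ?_)
  rw [lintegral_mul_const _ (by fun_prop), lintegral_exp_neg_mul_Ioi hq]

lemma weightedResolvent_one [IsProbabilityMeasure P] (hS : IsStableHalfProcess P S 𝓖)
    {μ q lam w₀ w : ℝ} (hμ : 0 < μ) (hq : 0 < q) (hlam : 0 < lam)
    (hw₀ : 1 < 2 * μ * w₀) (hw : 1 < 2 * μ * w) (hlt : w₀ < w)
    (hqw : μ * w₀ ^ 2 - w₀ = q) (hrw : μ * w ^ 2 - w = q + lam) :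
    weightedResolvent P S μ (q + lam) lam 1 =
      ENNReal.ofReal (1 / (q + lam) * (w ^ 2 / w₀ ^ 2)) := by
  have hw₀pos : 0 < w₀ := by
    by_contra h
    have : 2 * μ * w₀ ≤ 0 := mul_nonpos_of_nonneg_of_nonpos (by linarith) (not_lt.1 h)
    linarith
  set r := q + lam with hr
  have hr0 : 0 < r := by positivity
  set V := potential μ r with hV
  have hVu : V univ = ENNReal.ofReal (1 / r) := potential_univ μ hr0
  let e : (ℝ → ℝ≥0∞) → ℝ≥0∞ := fun f =>
    ∫⁻ x in Iio (0 : ℝ), ENNReal.ofReal ((w ^ 2 - w₀ ^ 2) / lam * exp (w₀ ^ 2 * x)) * f x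
  let N : (ℝ → ℝ≥0∞) → ℝ≥0∞ := fun f => weightedResolvent P S μ r lam ((Iic 0).indicator f)
  let T : (ℝ → ℝ≥0∞) → ℝ → ℝ≥0∞ := fun f y => ∫⁻ z, (Iic (0 : ℝ)).indicator f (y + z) ∂V
  let v : (ℝ → ℝ≥0∞) → ℝ≥0∞ := fun f => ∫⁻ z in Iic 0, f z ∂V
  have hT : ∀ f, Measurable f → Measurable (T f) := by
    intro f hf
    exact Measurable.lintegral_prod_right' (f := fun p : ℝ × ℝ => (Iic (0 : ℝ)).indicator f (p.1 + p.2))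
      ((hf.indicator measurableSet_Iic).comp (by fun_prop))
  have hTb : ∀ f c, Measurable f → (∀ x, f x ≤ c) → ∀ x, T f x ≤ ENNReal.ofReal (1 / r) * c := by
    intro f c hf hfc x
    calc T f x ≤ ∫⁻ _, c ∂V := lintegral_mono fun z =>
          (indicator_le_self' (fun _ _ => zero_le) _).trans (hfc _)
      _ = _ := by rw [lintegral_const, hVu, mul_comm]
  have hlm : ENNReal.ofReal lam * ENNReal.ofReal (1 / r) < 1 := by
    rw [← ENNReal.ofReal_mul hlam.le, ← ENNReal.ofReal_one, mul_one_div]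
    refine (ENNReal.ofReal_lt_ofReal_iff zero_lt_one).2 ?_
    rw [div_lt_one hr0]
    linarith
  have hN : ∀ f, Measurable f → N f = v f + ENNReal.ofReal lam * N (T f) := by
    intro f hf
    have := hS.weightedResolvent_eq μ r hlam.le (hf.indicator (measurableSet_Iic (a := (0 : ℝ))))
    rwa [lintegral_indicator measurableSet_Iic] at this
  have he : ∀ f, Measurable f → e f = v f + ENNReal.ofReal lam * e (T f) := fun f hf =>
    exp_renewal hμ hlam hw₀ hw hlt hqw hrw hf
  have hNb : ∀ f c, Measurable f → (∀ x, f x ≤ c) → N f ≤ ENNReal.ofReal (1 / q) * c := by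
    intro f c hf hfc
    exact (weightedResolvent_mono P S μ r lam fun x =>
      (indicator_le_self' (fun _ _ => zero_le) _).trans (hfc x)).trans
        (weightedResolvent_const_le S μ hq hlam.le c)
  have hK : 0 ≤ (w ^ 2 - w₀ ^ 2) / lam := by
    have : w₀ ^ 2 ≤ w ^ 2 := by gcongr
    exact div_nonneg (by linarith) hlam.le
  have he1 : e 1 = ENNReal.ofReal ((w ^ 2 - w₀ ^ 2) / lam * (1 / w₀ ^ 2)) := by
    simp only [e, Pi.one_apply, mul_one]
    simp_rw [ENNReal.ofReal_mul hK]
    rw [lintegral_const_mul _ (by fun_prop), setLIntegral_congr Iio_ae_eq_Iic,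
      lintegral_Iic_exp (by positivity)]
    simp
  have heb : ∀ f c, Measurable f → (∀ x, f x ≤ c) → e f ≤ e 1 * c := by
    intro f c hf hfc
    simp only [e, Pi.one_apply, mul_one]
    rw [← lintegral_mul_const _ (by fun_prop)]
    gcongr
    exact hfc _
  have hNe : N 1 = e 1 := le_antisymm
    (le_of_contracting_renewal hlm ENNReal.ofReal_ne_top hT hTb hN he hNb measurable_one
      fun _ => le_rfl)
    (le_of_contracting_renewal hlm (by rw [he1]; exact ENNReal.ofReal_ne_top) hT hTb he hN heb
      measurable_one fun _ => le_rfl)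
  have hfin := hS.weightedResolvent_eq μ r hlam.le (measurable_one (α := ℝ≥0∞) (β := ℝ))
  have hind : weightedResolvent P S μ r lam ((Iic 0).indicator fun y => ∫⁻ z, (1 : ℝ → ℝ≥0∞) (y + z) ∂V)
      = ENNReal.ofReal (1 / r) * N 1 := by
    simp only [Pi.one_apply, lintegral_one, hVu, N]
    unfold weightedResolvent
    rw [← lintegral_const_mul' _ _ ENNReal.ofReal_ne_top]
    refine lintegral_congr fun t => ?_
    rw [mul_left_comm]
    congr 1
    rw [← lintegral_const_mul' _ _ ENNReal.ofReal_ne_top]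
    refine lintegral_congr fun ω => ?_
    by_cases h : S t ω - μ * t ∈ Iic 0
    · rw [indicator_of_mem h, indicator_of_mem h, Pi.one_apply, mul_one, mul_comm]
    · simp [indicator_of_notMem h]
  rw [hfin, hind, hNe, he1, ← ENNReal.ofReal_mul (by positivity), ← ENNReal.ofReal_mul hlam.le]
  simp only [Pi.one_apply, lintegral_one]
  rw [← hV, hVu, ← ENNReal.ofReal_add (by positivity)
    (mul_nonneg hlam.le (mul_nonneg (by positivity) (mul_nonneg hK (by positivity))))]
  congr 1
  field_simp
  ring

end IsStableHalfProcess

lemma integral_ite_pos_eq_sub_timeBelow {μ t : ℝ} {x y : ℝ → ℝ} (hx : Measurable x) (ht : 0 ≤ t)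
    (hxy : ∀ s, 0 < s → y s = x s) :
    ∫ s in (0 : ℝ)..t, (if 0 < y s - μ * s then (1 : ℝ) else 0) = t - timeBelow μ x t := by
  have hU : MeasurableSet {u | x u ≤ μ * u} := measurableSet_le hx (by fun_prop)
  have h1 : ∫ s in (0 : ℝ)..t, (if 0 < y s - μ * s then (1 : ℝ) else 0) =
      ∫ s in (0 : ℝ)..t, (1 - {u | x u ≤ μ * u}.indicator (1 : ℝ → ℝ) s) := by
    refine intervalIntegral.integral_congr_ae (ae_of_all _ fun s hs => ?_)
    rw [uIoc_of_le ht] at hs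
    rw [hxy s hs.1]
    by_cases h : x s ≤ μ * s
    · simp [h]
    · simp [h, not_le.1 h]
  rw [h1, intervalIntegral.integral_sub intervalIntegrable_const
    (intervalIntegrable_indicator_one hU _ _)]
  simp [timeBelow]

lemma IsStableHalfProcess.integral_exp_sojourn {Ω : Type*} [MeasurableSpace Ω] {P : Measure Ω}
    [IsProbabilityMeasure P] {S D : ℝ → Ω → ℝ} {𝓖 : ℝ → MeasurableSpace Ω}
    (hS : IsStableHalfProcess P S 𝓖) (hD : ∀ᵐ ω ∂P, ∀ s, 0 < s → D s ω = S s ω)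
    {μ q lam w₀ w : ℝ} (hμ : 0 < μ) (hq : 0 < q) (hlam : 0 < lam)
    (hw₀ : 1 < 2 * μ * w₀) (hw : 1 < 2 * μ * w) (hlt : w₀ < w)
    (hqw : μ * w₀ ^ 2 - w₀ = q) (hrw : μ * w ^ 2 - w = q + lam) :
    ∫ t in Ioi (0 : ℝ), exp (-q * t) * ∫ ω, exp (-lam *
      ∫ s in (0 : ℝ)..t, (if 0 < D s ω - μ * s then (1 : ℝ) else 0)) ∂P =
      1 / (q + lam) * (w ^ 2 / w₀ ^ 2) := by
  have hone := hS.weightedResolvent_one hμ hq hlam hw₀ hw hlt hqw hrw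
  have htb : Measurable fun p : ℝ × Ω => timeBelow μ (fun u => S u p.2) p.1 :=
    measurable_timeBelow μ hS.measurable
  have hstep : ∀ t ∈ Ioi (0 : ℝ), exp (-q * t) * ∫ ω, exp (-lam *
      ∫ s in (0 : ℝ)..t, (if 0 < D s ω - μ * s then (1 : ℝ) else 0)) ∂P =
      (ENNReal.ofReal (exp (-(q + lam) * t)) *
        ∫⁻ ω, ENNReal.ofReal (exp (lam * timeBelow μ (fun u => S u ω) t)) ∂P).toReal := by
    intro t ht
    have hmt : Measurable fun ω => exp (lam * timeBelow μ (fun u => S u ω) t) :=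
      ((htb.comp (by fun_prop : Measurable fun ω => (t, ω))).const_mul lam).exp
    rw [ENNReal.toReal_mul, ENNReal.toReal_ofReal (exp_pos _).le,
      ← integral_eq_lintegral_of_nonneg_ae (ae_of_all _ fun ω => (exp_pos _).le)
        hmt.aestronglyMeasurable,
      show -(q + lam) * t = -q * t + -lam * t by ring, exp_add, mul_assoc]
    congr 1
    rw [← integral_const_mul]
    refine integral_congr_ae ?_
    filter_upwards [hD] with ω hω
    rw [integral_ite_pos_eq_sub_timeBelow (x := fun s => S s ω)
      (hS.measurable.comp (by fun_prop : Measurable fun s : ℝ => (s, ω))) (le_of_lt ht) hω,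
      ← exp_add]
    ring_nf
  have hmeas : Measurable fun t => ENNReal.ofReal (exp (-(q + lam) * t)) *
      ∫⁻ ω, ENNReal.ofReal (exp (lam * timeBelow μ (fun u => S u ω) t)) ∂P :=
    Measurable.mul (by fun_prop) (htb.const_mul lam).exp.ennreal_ofReal.lintegral_prod_right'
  simp only [IsStableHalfProcess.weightedResolvent, Pi.one_apply, mul_one] at hone
  rw [setIntegral_congr_fun measurableSet_Ioi hstep, integral_toReal hmeas.aemeasurable, hone,
    ENNReal.toReal_ofReal (by positivity)]
  refine ae_lt_top hmeas ?_
  rw [hone]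
  exact ENNReal.ofReal_ne_top

lemma IsStableHalfProcess.double_laplace {Ω : Type*} [MeasurableSpace Ω] {P : Measure Ω}
    [IsProbabilityMeasure P] {S D : ℝ → Ω → ℝ} {𝓖 : ℝ → MeasurableSpace Ω}
    (hS : IsStableHalfProcess P S 𝓖) (hD : ∀ᵐ ω ∂P, ∀ s, 0 < s → D s ω = S s ω)
    {μ q lam b : ℝ} (hμ : 0 < μ) (hb : b = 1 / (4 * μ)) (hq : 0 < q) (hlam : 0 < lam) :
    ∫ t in Ioi (0 : ℝ), exp (-q * t) * ∫ ω, exp (-lam *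
      ∫ s in (0 : ℝ)..t, (if 0 < D s ω - μ * s then (1 : ℝ) else 0)) ∂P =
      1 / (q + lam) * ((√b + √(q + lam + b)) / (√b + √(q + b))) ^ 2 := by
  have hb0 : 0 < b := by rw [hb]; positivity
  have hsb : √b ^ 2 = b := sq_sqrt hb0.le
  have hsb0 : 0 < √b := sqrt_pos.2 hb0
  have hμb : 4 * μ * b = 1 := by rw [hb]; field_simp
  have hroot : ∀ r, 0 < r → 1 < 2 * μ * (2 * √b * (√b + √(r + b))) ∧
      μ * (2 * √b * (√b + √(r + b))) ^ 2 - 2 * √b * (√b + √(r + b)) = r := by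
    intro r hr
    have hs : √(r + b) ^ 2 = r + b := sq_sqrt (by positivity)
    have hs0 : 0 < √(r + b) := sqrt_pos.2 (by positivity)
    constructor
    · have : 2 * μ * (2 * √b * (√b + √(r + b))) = 4 * μ * √b ^ 2 + 4 * μ * (√b * √(r + b)) := by
        ring
      rw [this, hsb, hμb]
      have : 0 < 4 * μ * (√b * √(r + b)) := by positivity
      linarith
    · have : μ * (2 * √b * (√b + √(r + b))) ^ 2 =
          (4 * μ * √b ^ 2) * (√b ^ 2 + 2 * (√b * √(r + b)) + √(r + b) ^ 2) := by ring
      rw [this, hsb, hμb, hs]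
      linear_combination (-2 : ℝ) * hsb
  have hlt : 2 * √b * (√b + √(q + b)) < 2 * √b * (√b + √(q + lam + b)) := by
    have : √(q + b) < √(q + lam + b) := sqrt_lt_sqrt (by positivity) (by linarith)
    gcongr
  rw [hS.integral_exp_sojourn hD hμ hq hlam (hroot q hq).1 (hroot (q + lam) (by positivity)).1 hlt
    (hroot q hq).2 (hroot (q + lam) (by positivity)).2, ← div_pow, mul_div_mul_left _ _ (by positivity)]

lemma IsBrownianMotion.congr {P : Measure Ω} {B B' : ℝ → Ω → ℝ} (hB : IsBrownianMotion P B)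
    (hm : ∀ t, Measurable (B' t)) (h : ∀ᵐ ω ∂P, ∀ t, B' t ω = B t ω) :
    IsBrownianMotion P B' where
  measurable := hm
  start := by filter_upwards [hB.start, h] with ω h0 h using by rw [h, h0]
  cont := by
    filter_upwards [hB.cont, h] with ω h0 h
    simpa only [h] using h0
  gauss s t hs hst := by
    rw [← hB.gauss s t hs hst]
    refine Measure.map_congr ?_
    filter_upwards [h] with ω h using by rw [h, h]
  indep s t hs hst n u hu := by
    refine (hB.indep s t hs hst n u hu).congr ?_ ?_
    · filter_upwards [h] with ω h using by rw [h, h]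
    · filter_upwards [h] with ω h using by simp only [h]

open Classical in
lemma IsBrownianMotion.exists_modification {P : Measure Ω} {B : ℝ → Ω → ℝ}
    (hB : IsBrownianMotion P B) {p : (ℝ → ℝ) → Prop} (hp : ∀ᵐ ω ∂P, p fun t => B t ω)
    (hp0 : p fun t => t) :
    ∃ B' : ℝ → Ω → ℝ, IsBrownianMotion P B' ∧ (∀ᵐ ω ∂P, ∀ t, B' t ω = B t ω) ∧
      ∀ ω, p fun t => B' t ω := by
  obtain ⟨N, hN, hNm, hNp⟩ := hp.exists_measurable_mem
  have hae : ∀ᵐ ω ∂P, ∀ t, (if ω ∈ N then B t ω else t) = B t ω := by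
    filter_upwards [hN] with ω hω t using if_pos hω
  refine ⟨fun t ω => if ω ∈ N then B t ω else t,
    hB.congr (fun t => Measurable.ite hNm (hB.measurable t) measurable_const) hae, hae, fun ω => ?_⟩
  by_cases h : ω ∈ N
  · simpa only [h, if_true] using hNp ω h
  · simpa only [h, if_false] using hp0

/-- The first time the path `x` reaches the level `a`. -/
def hitTime (x : ℝ → ℝ) (a : ℝ) : ℝ := sInf {s | 0 ≤ s ∧ a ≤ x s}

lemma hitTime_nonneg (x : ℝ → ℝ) (a : ℝ) : 0 ≤ hitTime x a := Real.sInf_nonneg fun _ h => h.1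

lemma hitTime_le {x : ℝ → ℝ} {a s : ℝ} (hs : 0 ≤ s) (h : a ≤ x s) : hitTime x a ≤ s :=
  csInf_le ⟨0, fun _ h => h.1⟩ ⟨hs, h⟩

lemma le_apply_hitTime {x : ℝ → ℝ} (hx : Continuous x) {a : ℝ} (h : ∃ s, 0 ≤ s ∧ a ≤ x s) :
    a ≤ x (hitTime x a) := by
  have hcl : IsClosed {s | 0 ≤ s ∧ a ≤ x s} :=
    (isClosed_le continuous_const continuous_id).inter (isClosed_le continuous_const hx)
  exact (hcl.csInf_mem h ⟨0, fun _ h => h.1⟩).2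

lemma hitTime_le_iff {x : ℝ → ℝ} (hx : Continuous x) {a : ℝ} (h : ∃ s, 0 ≤ s ∧ a ≤ x s) {r : ℝ} :
    hitTime x a ≤ r ↔ ∃ u ∈ Icc 0 r, a ≤ x u :=
  ⟨fun hr => ⟨_, ⟨hitTime_nonneg x a, hr⟩, le_apply_hitTime hx h⟩,
    fun ⟨_, hu, hau⟩ => (hitTime_le hu.1 hau).trans hu.2⟩

lemma apply_hitTime {x : ℝ → ℝ} (hx : Continuous x) (hx0 : x 0 = 0) {a : ℝ} (ha : 0 ≤ a)
    (h : ∃ s, 0 ≤ s ∧ a ≤ x s) : x (hitTime x a) = a := by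
  obtain ⟨v, hv, hva⟩ := intermediate_value_Icc (hitTime_nonneg x a) hx.continuousOn
    (show a ∈ Icc (x 0) (x (hitTime x a)) from ⟨hx0.trans_le ha, le_apply_hitTime hx h⟩)
  rw [le_antisymm (hitTime_le hv.1 hva.ge) hv.2, hva]

lemma hitTime_of_nonpos {x : ℝ → ℝ} (hx0 : x 0 = 0) {a : ℝ} (ha : a ≤ 0) : hitTime x a = 0 :=
  le_antisymm (hitTime_le le_rfl (ha.trans_eq hx0.symm)) (hitTime_nonneg x a)

lemma hitTime_mono {x : ℝ → ℝ} (hx : Continuous x) {a a' : ℝ} (haa : a ≤ a')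
    (h : ∃ s, 0 ≤ s ∧ a' ≤ x s) : hitTime x a ≤ hitTime x a' :=
  hitTime_le (hitTime_nonneg x a') (haa.trans (le_apply_hitTime hx h))

lemma sInf_eq_hitTime {x : ℝ → ℝ} (hx : Continuous x) (hx0 : x 0 = 0) {a : ℝ} (ha : 0 < a)
    (h : ∃ s, 0 ≤ s ∧ a ≤ x s) : sInf {s | 0 < s ∧ x s = a} = hitTime x a := by
  have heq := apply_hitTime hx hx0 ha.le h
  have hpos : 0 < hitTime x a := by
    refine (hitTime_nonneg x a).lt_of_ne fun h0 => ?_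
    rw [← h0, hx0] at heq
    exact ha.ne heq
  exact le_antisymm (csInf_le ⟨0, fun _ h => h.1.le⟩ ⟨hpos, heq⟩)
    (le_csInf ⟨_, hpos, heq⟩ fun s hs => hitTime_le hs.1.le hs.2.ge)

/-- Reaching a level strictly after time `r` is witnessed at a lower rational level. -/
lemma lt_hitTime_iff {x : ℝ → ℝ} (hx : Continuous x) (hub : ∀ a, ∃ s, 0 ≤ s ∧ a ≤ x s) (a r : ℝ) :
    r < hitTime x a ↔ ∃ v : ℚ, (v : ℝ) < a ∧ r < hitTime x v := by
  constructor
  · intro h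
    rcases lt_or_ge r 0 with hr | hr
    · obtain ⟨v, hv⟩ := exists_rat_lt a
      exact ⟨v, hv, hr.trans_le (hitTime_nonneg x v)⟩
    obtain ⟨u, hu, hmax⟩ := isCompact_Icc.exists_isMaxOn (nonempty_Icc.2 hr) hx.continuousOn
    have hua : x u < a := by
      by_contra hc
      exact h.not_ge ((hitTime_le_iff hx (hub a)).2 ⟨u, hu, not_lt.1 hc⟩)
    obtain ⟨v, hv, hva⟩ := exists_rat_btwn hua
    refine ⟨v, hva, lt_of_not_ge fun hc => ?_⟩
    obtain ⟨w, hw, hvw⟩ := (hitTime_le_iff hx (hub v)).1 hc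
    exact (hv.trans_le hvw).not_ge (hmax hw)
  · rintro ⟨v, hva, h⟩
    exact h.trans_le (hitTime_mono hx hva.le (hub a))

/-- The events determined by the process `B` on `[0, r]`. -/
abbrev past {E : Type*} (B : ℝ → E → ℝ) (r : ℝ) : MeasurableSpace E :=
  MeasurableSpace.comap (fun ω (u : Icc 0 r) => B u ω) inferInstance

/-- The event that `B` reaches the level `a` during `[0, r]`. -/
def reachEvent {E : Type*} (B : ℝ → E → ℝ) (a r : ℝ) : Set E := {ω | ∃ u ∈ Icc 0 r, a ≤ B u ω}

lemma past_le {B : ℝ → Ω → ℝ} (hm : ∀ t, Measurable (B t)) (r : ℝ) :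
    past B r ≤ (inferInstance : MeasurableSpace Ω) :=
  (measurable_pi_lambda _ fun u : Icc 0 r => hm u).comap_le

lemma measurable_past {E : Type*} {B : ℝ → E → ℝ} {u r : ℝ} (hu : u ∈ Icc 0 r) :
    Measurable[past B r] (B u) :=
  (measurable_pi_apply (⟨u, hu⟩ : Icc 0 r)).comp
    (comap_measurable fun ω (u : Icc 0 r) => B u ω)

lemma past_mono {E : Type*} {B : ℝ → E → ℝ} {r r' : ℝ} (h : r ≤ r') : past B r ≤ past B r' := by
  refine Measurable.comap_le ?_
  exact @measurable_pi_lambda _ _ _ (past B r') _ _ fun u =>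
    measurable_past ⟨u.2.1, u.2.2.trans h⟩

lemma indep_past {P : Measure Ω} [IsProbabilityMeasure P] {B : ℝ → Ω → ℝ}
    (hB : IsBrownianMotion P B) {s t : ℝ} (hs : 0 ≤ s) (hst : s ≤ t) :
    Indep (MeasurableSpace.comap (fun ω => B t ω - B s ω) inferInstance) (past B s) P := by
  change IndepFun (fun ω => B t ω - B s ω) (fun ω (u : Icc 0 s) => B u ω) P
  refine IndepFun.indepFun_process ((hB.measurable t).sub (hB.measurable s))
    (fun u => hB.measurable u) fun I => ?_
  have h := hB.indep s t hs hst I.card (fun i => ((I.equivFin.symm i : I) : Icc 0 s))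
    fun i => ((I.equivFin.symm i : I) : Icc 0 s).2
  convert h.comp measurable_id (measurable_pi_lambda
    (fun (y : Fin I.card → ℝ) (i : I) => y (I.equivFin i)) fun i => measurable_pi_apply _) using 2
  · rfl
  · funext i
    simp

lemma measurableSet_reachEvent {E : Type*} {B : ℝ → E → ℝ}
    (hc : ∀ ω, Continuous fun t => B t ω) (a r : ℝ) :
    MeasurableSet[past B r] (reachEvent B a r) := by
  obtain ⟨D, hDc, hDd⟩ := TopologicalSpace.exists_countable_dense (Icc (0 : ℝ) r)
  have heq : reachEvent B a r = ⋂ n : ℕ, ⋃ d ∈ D, {ω | a - 1 / (n + 1 : ℝ) < B d ω} := by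
    ext ω
    simp only [reachEvent, mem_ofPred_eq, mem_iInter, mem_iUnion, exists_prop]
    constructor
    · rintro ⟨u, hu, hau⟩ n
      have hopen : IsOpen {v : Icc (0 : ℝ) r | a - 1 / (n + 1 : ℝ) < B v ω} :=
        isOpen_lt continuous_const ((hc ω).comp continuous_subtype_val)
      obtain ⟨v, hv, hvD⟩ := hDd.inter_open_nonempty _ hopen
        ⟨⟨u, hu⟩, (sub_lt_self a Nat.one_div_pos_of_nat).trans_le hau⟩
      exact ⟨v, hvD, hv⟩
    · intro h
      obtain ⟨d, -, -⟩ := h 0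
      obtain ⟨u, hu, hmax⟩ := isCompact_Icc.exists_isMaxOn ⟨d.1, d.2⟩
        (hc ω).continuousOn
      refine ⟨u, hu, le_of_not_gt fun hlt => ?_⟩
      obtain ⟨n, hn⟩ := exists_nat_one_div_lt (sub_pos.2 hlt)
      obtain ⟨d, -, hd⟩ := h n
      have := hmax d.2
      simp only [mem_ofPred_eq] at this
      linarith
  rw [heq]
  refine MeasurableSet.iInter fun n => MeasurableSet.biUnion hDc fun d _ => ?_
  exact measurable_past d.2 measurableSet_Ioi

lemma reachEvent_mono_right {E : Type*} {B : ℝ → E → ℝ} {a r r' : ℝ} (h : r ≤ r') :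
    reachEvent B a r ⊆ reachEvent B a r' :=
  fun _ ⟨u, hu, hau⟩ => ⟨u, ⟨hu.1, hu.2.trans h⟩, hau⟩

lemma reachEvent_anti_left {E : Type*} {B : ℝ → E → ℝ} {a a' r : ℝ} (h : a ≤ a') :
    reachEvent B a' r ⊆ reachEvent B a r :=
  fun _ ⟨u, hu, hau⟩ => ⟨u, hu, h.trans hau⟩

/-- The events determined by the continuous process `B` up to the first time it reaches `a`. -/
abbrev hitPast (B : ℝ → Ω → ℝ) (hc : ∀ ω, Continuous fun t => B t ω) (a : ℝ) :
    MeasurableSpace Ω where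
  MeasurableSet' A := MeasurableSet A ∧ ∀ r, MeasurableSet[past B r] (A ∩ reachEvent B a r)
  measurableSet_empty := ⟨MeasurableSet.empty, fun r => by
    rw [empty_inter]; exact @MeasurableSet.empty _ (past B r)⟩
  measurableSet_compl A hA := ⟨hA.1.compl, fun r => by
    have : Aᶜ ∩ reachEvent B a r = reachEvent B a r \ (A ∩ reachEvent B a r) := by
      ext ω; simp only [mem_inter_iff, mem_compl_iff, Set.mem_sdiff]; tauto
    rw [this]
    exact (measurableSet_reachEvent hc a r).diff (hA.2 r)⟩
  measurableSet_iUnion f hf := ⟨MeasurableSet.iUnion fun i => (hf i).1, fun r => by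
    rw [iUnion_inter]
    exact MeasurableSet.iUnion fun i => (hf i).2 r⟩

lemma hitPast_le {B : ℝ → Ω → ℝ} (hc : ∀ ω, Continuous fun t => B t ω) (a : ℝ) :
    hitPast B hc a ≤ (inferInstance : MeasurableSpace Ω) := fun _ hA => hA.1

lemma hitPast_mono {B : ℝ → Ω → ℝ} (hc : ∀ ω, Continuous fun t => B t ω) {a a' : ℝ}
    (h : a ≤ a') : hitPast B hc a ≤ hitPast B hc a' := by
  refine fun A hA => ⟨hA.1, fun r => ?_⟩
  have : A ∩ reachEvent B a' r = (A ∩ reachEvent B a r) ∩ reachEvent B a' r := by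
    rw [inter_assoc, inter_eq_self_of_subset_right (reachEvent_anti_left h)]
  rw [this]
  exact (hA.2 r).inter (measurableSet_reachEvent hc a' r)

lemma exists_of_mem_reachEvent {E : Type*} {B : ℝ → E → ℝ} {a r : ℝ} {ω : E}
    (h : ω ∈ reachEvent B a r) :
    ∃ s, 0 ≤ s ∧ a ≤ B s ω :=
  let ⟨u, hu, hau⟩ := h
  ⟨u, hu.1, hau⟩

lemma iUnion_reachEvent {E : Type*} (B : ℝ → E → ℝ) (a : ℝ) :
    ⋃ n : ℕ, reachEvent B a n = {ω | ∃ s, 0 ≤ s ∧ a ≤ B s ω} := by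
  ext ω
  simp only [mem_iUnion, mem_ofPred_eq]
  refine ⟨fun ⟨n, hn⟩ => exists_of_mem_reachEvent hn, fun ⟨s, hs, has⟩ => ?_⟩
  obtain ⟨n, hn⟩ := exists_nat_ge s
  exact ⟨n, s, ⟨hs, hn⟩, has⟩

lemma measurable_hitTime {B : ℝ → Ω → ℝ} (hm : ∀ t, Measurable (B t))
    (hc : ∀ ω, Continuous fun t => B t ω) (a : ℝ) :
    Measurable[hitPast B hc a] fun ω => hitTime (fun t => B t ω) a := by
  have hR : ∀ r, MeasurableSet (reachEvent B a r) := fun r =>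
    past_le hm r _ (measurableSet_reachEvent hc a r)
  refine measurable_of_Iic fun ρ => ⟨?_, fun r => ?_⟩
  · rcases lt_or_ge ρ 0 with hρ | hρ
    · convert MeasurableSet.empty
      ext ω
      simpa using hρ.trans_le (hitTime_nonneg (fun t => B t ω) a)
    have : (fun ω => hitTime (fun t => B t ω) a) ⁻¹' Iic ρ =
        reachEvent B a ρ ∪ (⋃ n : ℕ, reachEvent B a n)ᶜ := by
      ext ω
      rw [iUnion_reachEvent]
      simp only [mem_preimage, mem_Iic, mem_union, mem_compl_iff, mem_ofPred_eq]
      by_cases h : ∃ s, 0 ≤ s ∧ a ≤ B s ω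
      · simp only [h, not_true, or_false]
        exact hitTime_le_iff (hc ω) h
      · have : {s | 0 ≤ s ∧ a ≤ B s ω} = ∅ := eq_empty_of_forall_notMem fun s hs => h ⟨s, hs⟩
        simp [h, hitTime, this, hρ]
    rw [this]
    exact (hR ρ).union (MeasurableSet.iUnion fun n : ℕ => hR n).compl
  · have : (fun ω => hitTime (fun t => B t ω) a) ⁻¹' Iic ρ ∩ reachEvent B a r =
        reachEvent B a (min ρ r) := by
      ext ω
      constructor
      · rintro ⟨h1, h2⟩
        have hex := exists_of_mem_reachEvent h2
        exact (hitTime_le_iff (hc ω) hex).1 (le_min h1 ((hitTime_le_iff (hc ω) hex).2 h2))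
      · intro h
        exact ⟨(hitTime_le_iff (hc ω) (exists_of_mem_reachEvent h)).2
          (reachEvent_mono_right (min_le_left _ _) h), reachEvent_mono_right (min_le_right _ _) h⟩
    rw [this]
    exact past_mono (min_le_right _ _) _ (measurableSet_reachEvent hc a _)

/-- The mean of `F` under the centred normal law of variance `v`. -/
def gaussAvg (F : ℝ → ℝ≥0∞) (v : ℝ) : ℝ≥0∞ := ∫⁻ x, F (√v * x) ∂gaussianReal 0 1

lemma gaussAvg_eq {F : ℝ → ℝ≥0∞} (hF : Measurable F) {v : ℝ} (hv : 0 ≤ v) :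
    gaussAvg F v = ∫⁻ x, F x ∂gaussianReal 0 v.toNNReal := by
  have h := gaussianReal_map_const_mul (μ := 0) (v := 1) (√v)
  have hv' : NNReal.mk ((√v) ^ 2) (sq_nonneg _) * 1 = v.toNNReal := by
    ext
    simp [Real.sq_sqrt hv, hv]
  rw [mul_zero, hv'] at h
  rw [← h, lintegral_map hF (measurable_const_mul _), gaussAvg]

lemma gaussAvg_le {F : ℝ → ℝ≥0∞} {K : ℝ≥0∞} (hK : ∀ x, F x ≤ K) (v : ℝ) : gaussAvg F v ≤ K :=
  (lintegral_mono fun _ => hK _).trans (by simp)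

lemma continuous_gaussAvg {F : ℝ → ℝ≥0∞} (hF : Continuous F) {K : ℝ≥0∞} (hK : ∀ x, F x ≤ K)
    (hKt : K ≠ ∞) : Continuous (gaussAvg F) := by
  refine continuous_iff_continuousAt.2 fun v => ?_
  refine tendsto_lintegral_filter_of_dominated_convergence (fun _ => K)
    (Eventually.of_forall fun w => (hF.comp (by fun_prop)).measurable)
    (Eventually.of_forall fun w => Eventually.of_forall fun x => hK _) (by simpa using hKt)
    (Eventually.of_forall fun x => ?_)
  have : Continuous fun w => F (√w * x) := hF.comp (by fun_prop)
  exact this.tendsto v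

lemma setLIntegral_increment {P : Measure Ω} [IsProbabilityMeasure P] {B : ℝ → Ω → ℝ}
    (hB : IsBrownianMotion P B) {F : ℝ → ℝ≥0∞} (hF : Measurable F) {s t : ℝ} (hs : 0 ≤ s)
    (hst : s ≤ t) {C : Set Ω} (hC : MeasurableSet[past B s] C) :
    ∫⁻ ω in C, F (B t ω - B s ω) ∂P = P C * gaussAvg F (t - s) := by
  have hm : Measurable fun ω => B t ω - B s ω := (hB.measurable t).sub (hB.measurable s)
  have hC' : MeasurableSet C := past_le hB.measurable s _ hC
  have hind : Measurable[past B s] (C.indicator fun _ => (1 : ℝ≥0∞)) :=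
    Measurable.indicator (@measurable_const _ _ _ (past B s) _) hC
  have h := lintegral_mul_eq_lintegral_mul_lintegral_of_independent_measurableSpace
    hm.comap_le (past_le hB.measurable s) (indep_past hB hs hst)
    (f := fun ω => F (B t ω - B s ω)) (g := C.indicator fun _ => 1)
    (hF.comp (comap_measurable fun ω => B t ω - B s ω))
    hind
  rw [lintegral_indicator hC', setLIntegral_const, one_mul, mul_comm] at h
  rw [gaussAvg_eq hF (sub_nonneg.2 hst), ← hB.gauss s t hs hst, lintegral_map hF hm, ← h,
    ← lintegral_indicator hC']
  refine lintegral_congr fun ω => ?_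
  by_cases hω : ω ∈ C <;> simp [hω]

lemma tendsto_ceil_mul {N x : ℝ} (hN : 0 < N) (hx : 0 ≤ x) :
    Tendsto (fun n : ℕ => (⌈x / (N / (n + 1))⌉₊ : ℝ) * (N / (n + 1))) atTop (𝓝 x) := by
  have hlim : Tendsto (fun n : ℕ => x + N / ((n : ℝ) + 1)) atTop (𝓝 x) := by
    have h := (tendsto_one_div_add_atTop_nhds_zero_nat (𝕜 := ℝ)).const_mul N
    simpa [div_eq_mul_inv] using h.const_add x
  refine tendsto_of_tendsto_of_tendsto_of_le_of_le tendsto_const_nhds hlim (fun n => ?_) fun n => ?_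
  · have hh : 0 < N / ((n : ℝ) + 1) := by positivity
    have := Nat.le_ceil (x / (N / ((n : ℝ) + 1)))
    exact (div_le_iff₀ hh).1 this
  · have hh : 0 < N / ((n : ℝ) + 1) := by positivity
    have := (Nat.ceil_lt_add_one (div_nonneg hx hh.le)).le
    calc _ ≤ (x / (N / ((n : ℝ) + 1)) + 1) * (N / (n + 1)) := by gcongr
      _ = x + N / ((n : ℝ) + 1) := by
        rw [add_mul, div_mul_cancel₀ _ hh.ne', one_mul]

lemma setLIntegral_after_ceil_hitTime {P : Measure Ω} [IsProbabilityMeasure P] {B : ℝ → Ω → ℝ}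
    (hB : IsBrownianMotion P B) (hc : ∀ ω, Continuous fun t => B t ω) {F : ℝ → ℝ≥0∞}
    (hF : Measurable F) {a N : ℝ} (hN : 0 < N) {A : Set Ω} (hA : MeasurableSet[hitPast B hc a] A)
    (n : ℕ) :
    ∫⁻ ω in A ∩ reachEvent B a N,
        F (B N ω - B ((⌈hitTime (fun t => B t ω) a / (N / (n + 1))⌉₊ : ℝ) * (N / (n + 1))) ω) ∂P =
      ∫⁻ ω in A ∩ reachEvent B a N,
        gaussAvg F (N - (⌈hitTime (fun t => B t ω) a / (N / (n + 1))⌉₊ : ℝ) * (N / (n + 1))) ∂P := by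
  set h : ℝ := N / (n + 1) with hh
  have hpos : 0 < h := by positivity
  have hNh : N = (n + 1 : ℕ) * h := by rw [hh]; push_cast; field_simp
  set k : Ω → ℕ := fun ω => ⌈hitTime (fun t => B t ω) a / h⌉₊ with hk
  have hkm : Measurable[hitPast B hc a] k :=
    Nat.measurable_ceil.comp ((measurable_hitTime hB.measurable hc a).div_const h)
  have hkle : ∀ ω ∈ reachEvent B a N, k ω ≤ n + 1 := fun ω hω => by
    refine Nat.ceil_le.2 ((div_le_iff₀ hpos).2 ?_)
    rw [← hNh]
    exact (hitTime_le_iff (hc ω) (exists_of_mem_reachEvent hω)).2 hω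
  have hreach : ∀ ω ∈ reachEvent B a N, ω ∈ reachEvent B a (k ω * h) := fun ω hω =>
    (hitTime_le_iff (hc ω) (exists_of_mem_reachEvent hω)).1 ((div_le_iff₀ hpos).1 (Nat.le_ceil _))
  have hset : A ∩ reachEvent B a N = ⋃ j : ℕ, A ∩ reachEvent B a N ∩ k ⁻¹' {j} := by
    ext ω; simp
  have hAm : MeasurableSet (A ∩ reachEvent B a N) := past_le hB.measurable N _ (hA.2 N)
  have hCm : ∀ j, MeasurableSet (A ∩ reachEvent B a N ∩ k ⁻¹' {j}) := fun j =>
    hAm.inter (hitPast_le hc a _ (hkm (measurableSet_singleton j)))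
  have hdisj : Pairwise (Function.onFun Disjoint
      fun j : ℕ => A ∩ reachEvent B a N ∩ k ⁻¹' {j}) := by
    intro i j hij
    refine Set.disjoint_left.2 fun ω h1 h2 => hij ?_
    exact (h1.2 : k ω = i).symm.trans h2.2
  rw [hset, lintegral_iUnion hCm hdisj, lintegral_iUnion hCm hdisj]
  refine tsum_congr fun j => ?_
  rcases le_or_gt j (n + 1) with hj | hj
  · have hjN : j * h ≤ N := by
      rw [hNh]; gcongr
    have hC : A ∩ reachEvent B a N ∩ k ⁻¹' {j} = A ∩ k ⁻¹' {j} ∩ reachEvent B a (j * h) := by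
      ext ω
      constructor
      · rintro ⟨⟨h1, h2⟩, h3⟩
        refine ⟨⟨h1, h3⟩, ?_⟩
        have := hreach ω h2
        rwa [show k ω = j from h3] at this
      · rintro ⟨⟨h1, h3⟩, h2⟩
        exact ⟨⟨h1, reachEvent_mono_right hjN h2⟩, h3⟩
    have hpast : MeasurableSet[past B (j * h)] (A ∩ reachEvent B a N ∩ k ⁻¹' {j}) := by
      rw [hC]
      exact (MeasurableSet.inter hA (hkm (measurableSet_singleton j))).2 _
    have hkj : ∀ ω ∈ A ∩ reachEvent B a N ∩ k ⁻¹' {j}, k ω = j := fun ω hω => hω.2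
    rw [setLIntegral_congr_fun (g := fun ω => F (B N ω - B (j * h) ω)) (hCm j)
        fun ω hω => by rw [← hkj ω hω],
      setLIntegral_congr_fun (f := fun ω => gaussAvg F (N - k ω * h))
        (g := fun _ => gaussAvg F (N - j * h)) (hCm j)
        fun ω hω => by simp only [hkj ω hω],
      setLIntegral_increment hB hF (by positivity) hjN hpast, setLIntegral_const, mul_comm]
  · have : A ∩ reachEvent B a N ∩ k ⁻¹' {j} = ∅ := by
      refine eq_empty_of_forall_notMem fun ω hω => ?_
      have h1 := hkle ω hω.1.2
      have h2 : k ω = j := hω.2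
      lia
    simp [this]

lemma setLIntegral_after_hitTime {P : Measure Ω} [IsProbabilityMeasure P] {B : ℝ → Ω → ℝ}
    (hB : IsBrownianMotion P B) (hc : ∀ ω, Continuous fun t => B t ω) (h0 : ∀ ω, B 0 ω = 0)
    {F : ℝ → ℝ≥0∞} (hF : Continuous F) {K : ℝ≥0∞} (hK : ∀ x, F x ≤ K) (hKt : K ≠ ∞)
    {a N : ℝ} (ha : 0 ≤ a) (hN : 0 < N) {A : Set Ω} (hA : MeasurableSet[hitPast B hc a] A) :
    ∫⁻ ω in A ∩ reachEvent B a N, F (B N ω - a) ∂P =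
      ∫⁻ ω in A ∩ reachEvent B a N, gaussAvg F (N - hitTime (fun t => B t ω) a) ∂P := by
  have hAm : MeasurableSet (A ∩ reachEvent B a N) := past_le hB.measurable N _ (hA.2 N)
  have hit : Measurable fun ω => hitTime (fun t => B t ω) a :=
    (measurable_hitTime hB.measurable hc a).mono (hitPast_le hc a) le_rfl
  have hunc : Measurable (Function.uncurry B) :=
    measurable_uncurry_of_continuous_of_measurable hc hB.measurable
  have hρ : ∀ n : ℕ, Measurable fun ω =>
      (⌈hitTime (fun t => B t ω) a / (N / (n + 1))⌉₊ : ℝ) * (N / (n + 1)) := fun n =>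
    ((measurable_from_top (f := fun j : ℕ => (j : ℝ))).comp
      (Nat.measurable_ceil.comp (hit.div_const _))).mul_const _
  have hcv : ∀ ω, Tendsto (fun n : ℕ =>
      (⌈hitTime (fun t => B t ω) a / (N / (n + 1))⌉₊ : ℝ) * (N / (n + 1))) atTop
      (𝓝 (hitTime (fun t => B t ω) a)) := fun ω => tendsto_ceil_mul hN (hitTime_nonneg _ _)
  have hbound : ∫⁻ _ in A ∩ reachEvent B a N, K ∂P ≠ ∞ := by
    rw [setLIntegral_const]
    exact ENNReal.mul_ne_top hKt (measure_ne_top _ _)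
  have hg := continuous_gaussAvg hF hK hKt
  have L1 : Tendsto (fun n : ℕ => ∫⁻ ω in A ∩ reachEvent B a N,
      F (B N ω - B ((⌈hitTime (fun t => B t ω) a / (N / (n + 1))⌉₊ : ℝ) * (N / (n + 1))) ω) ∂P)
      atTop (𝓝 (∫⁻ ω in A ∩ reachEvent B a N, F (B N ω - a) ∂P)) := by
    refine tendsto_lintegral_of_dominated_convergence (fun _ => K)
      (fun n => hF.measurable.comp ((hB.measurable N).sub (hunc.comp ((hρ n).prodMk measurable_id))))
      (fun n => Eventually.of_forall fun ω => hK _) hbound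
      ((ae_restrict_iff' hAm).2 (Eventually.of_forall fun ω hω => ?_))
    have h1 : B (hitTime (fun t => B t ω) a) ω = a :=
      apply_hitTime (hc ω) (h0 ω) ha (exists_of_mem_reachEvent hω.2)
    have h2 := ((hF.comp ((continuous_const (y := B N ω)).sub (hc ω))).tendsto
      (hitTime (fun t => B t ω) a)).comp (hcv ω)
    simp only [Function.comp_def, Pi.sub_apply, h1] at h2
    exact h2
  have L2 : Tendsto (fun n : ℕ => ∫⁻ ω in A ∩ reachEvent B a N,
      gaussAvg F (N - (⌈hitTime (fun t => B t ω) a / (N / (n + 1))⌉₊ : ℝ) * (N / (n + 1))) ∂P)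
      atTop (𝓝 (∫⁻ ω in A ∩ reachEvent B a N, gaussAvg F (N - hitTime (fun t => B t ω) a) ∂P)) := by
    refine tendsto_lintegral_of_dominated_convergence (fun _ => K)
      (fun n => hg.measurable.comp ((hρ n).const_sub N))
      (fun n => Eventually.of_forall fun ω => gaussAvg_le hK _) hbound
      (Eventually.of_forall fun ω => ?_)
    exact ((hg.comp (continuous_const.sub continuous_id)).tendsto _).comp (hcv ω)
  refine tendsto_nhds_unique L1 (L2.congr fun n => ?_)
  exact (setLIntegral_after_ceil_hitTime hB hc hF.measurable hN hA n).symm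

lemma gaussAvg_exp (c : ℝ) {v : ℝ} (hv : 0 ≤ v) :
    gaussAvg (fun x => ENNReal.ofReal (exp (c * x))) v = ENNReal.ofReal (exp (c ^ 2 / 2 * v)) := by
  rw [gaussAvg_eq (by fun_prop) hv, ← ofReal_integral_eq_lintegral_ofReal
    (integrable_exp_mul_gaussianReal c) (Eventually.of_forall fun _ => (exp_pos _).le)]
  have h := mgf_gaussianReal (p := gaussianReal 0 v.toNNReal) (X := id) Measure.map_id c
  simp only [mgf, id] at h
  rw [h, Real.coe_toNNReal v hv]
  congr 2
  ring

lemma setLIntegral_exp_after_hitTime {P : Measure Ω} [IsProbabilityMeasure P] {B : ℝ → Ω → ℝ}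
    (hB : IsBrownianMotion P B) (hc : ∀ ω, Continuous fun t => B t ω) (h0 : ∀ ω, B 0 ω = 0)
    {a N : ℝ} (c : ℝ) (ha : 0 ≤ a) (hN : 0 < N) {A : Set Ω} (hA : MeasurableSet[hitPast B hc a] A) :
    ∫⁻ ω in A ∩ reachEvent B a N, ENNReal.ofReal (exp (c * (B N ω - a))) ∂P =
      ∫⁻ ω in A ∩ reachEvent B a N,
        ENNReal.ofReal (exp (c ^ 2 / 2 * (N - hitTime (fun t => B t ω) a))) ∂P := by
  have hAm : MeasurableSet (A ∩ reachEvent B a N) := past_le hB.measurable N _ (hA.2 N)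
  have hit : Measurable fun ω => hitTime (fun t => B t ω) a :=
    (measurable_hitTime hB.measurable hc a).mono (hitPast_le hc a) le_rfl
  let F : ℕ → ℝ → ℝ≥0∞ := fun K x => min (ENNReal.ofReal (exp (c * x))) K
  have hFc : ∀ K, Continuous (F K) := fun K =>
    (ENNReal.continuous_ofReal.comp (by fun_prop)).min continuous_const
  have hFmono : ∀ x, Monotone fun K => F K x := fun x i j hij =>
    min_le_min le_rfl (by exact_mod_cast hij)
  have hsup : ∀ x, ⨆ K, F K x = ENNReal.ofReal (exp (c * x)) := fun x => by
    refine le_antisymm (iSup_le fun K => min_le_left _ _) ?_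
    obtain ⟨K, hK⟩ := ENNReal.exists_nat_gt (ENNReal.ofReal_ne_top (r := exp (c * x)))
    exact le_iSup_of_le K (le_min le_rfl hK.le)
  have hgsup : ∀ v, ⨆ K, gaussAvg (F K) v =
      gaussAvg (fun x => ENNReal.ofReal (exp (c * x))) v := fun v => by
    simp only [gaussAvg, ← hsup]
    exact (lintegral_iSup (f := fun K x => F K (√v * x))
      (fun K => ((hFc K).comp (continuous_const_mul _)).measurable)
      fun i j hij x => hFmono _ hij).symm
  have key : ∀ K, _ := fun K : ℕ => setLIntegral_after_hitTime hB hc h0 (hFc K) (K := K)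
    (fun x => min_le_right _ _) (by simp) ha hN hA
  calc _ = ⨆ K, ∫⁻ ω in A ∩ reachEvent B a N, F K (B N ω - a) ∂P := by
        simp only [← hsup]
        exact lintegral_iSup (f := fun K ω => F K (B N ω - a))
          (fun K => (hFc K).measurable.comp ((hB.measurable N).sub_const a))
          fun i j hij ω => hFmono _ hij
    _ = ⨆ K, ∫⁻ ω in A ∩ reachEvent B a N,
          gaussAvg (F K) (N - hitTime (fun t => B t ω) a) ∂P := by simp only [key]
    _ = ∫⁻ ω in A ∩ reachEvent B a N, gaussAvg (fun x => ENNReal.ofReal (exp (c * x)))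
          (N - hitTime (fun t => B t ω) a) ∂P := by
        simp only [← hgsup]
        exact (lintegral_iSup (f := fun K ω => gaussAvg (F K) (N - hitTime (fun t => B t ω) a))
          (fun K => (continuous_gaussAvg (hFc K) (K := K)
            (fun x => min_le_right _ _) (by simp)).measurable.comp (hit.const_sub N))
          fun i j hij ω => lintegral_mono fun x => hFmono _ hij).symm
    _ = _ := by
        refine setLIntegral_congr_fun hAm fun ω hω => ?_
        exact gaussAvg_exp c (sub_nonneg.2
          ((hitTime_le_iff (hc ω) (exists_of_mem_reachEvent hω.2)).2 hω.2))

lemma setLIntegral_exp_stopped {P : Measure Ω} [IsProbabilityMeasure P] {B : ℝ → Ω → ℝ}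
    (hB : IsBrownianMotion P B) (hc : ∀ ω, Continuous fun t => B t ω) (h0 : ∀ ω, B 0 ω = 0)
    {a N : ℝ} (c : ℝ) (ha : 0 ≤ a) (hN : 0 < N) {A : Set Ω} (hA : MeasurableSet[hitPast B hc a] A) :
    ∫⁻ ω in A ∩ reachEvent B a N, ENNReal.ofReal (exp (c * B N ω - c ^ 2 / 2 * N)) ∂P =
      ∫⁻ ω in A ∩ reachEvent B a N,
        ENNReal.ofReal (exp (c * a - c ^ 2 / 2 * hitTime (fun t => B t ω) a)) ∂P := by
  have hit : Measurable fun ω => hitTime (fun t => B t ω) a :=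
    (measurable_hitTime hB.measurable hc a).mono (hitPast_le hc a) le_rfl
  have hBN := hB.measurable N
  have h := congrArg (fun z => ENNReal.ofReal (exp (c * a - c ^ 2 / 2 * N)) * z)
    (setLIntegral_exp_after_hitTime hB hc h0 c ha hN hA)
  rw [← lintegral_const_mul _ (by fun_prop), ← lintegral_const_mul _ (by fun_prop)] at h
  simp only [← ENNReal.ofReal_mul (exp_pos _).le, ← exp_add] at h
  convert h using 5 <;> ring

lemma tendsto_setLIntegral_reachEvent {P : Measure Ω} {B : ℝ → Ω → ℝ} (a : ℝ) (A : Set Ω)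
    (f : Ω → ℝ≥0∞) :
    Tendsto (fun n : ℕ => ∫⁻ ω in A ∩ reachEvent B a (n + 1 : ℕ), f ω ∂P) atTop
      (𝓝 (∫⁻ ω in A ∩ {ω | ∃ s, 0 ≤ s ∧ a ≤ B s ω}, f ω ∂P)) := by
  have hmono : Monotone fun n : ℕ => A ∩ reachEvent B a n := fun i j hij =>
    inter_subset_inter_right _ (reachEvent_mono_right (by exact_mod_cast hij))
  rw [← iUnion_reachEvent, inter_iUnion, setLIntegral_iUnion_of_directed _ hmono.directed_le]
  exact (tendsto_atTop_iSup fun i j hij => lintegral_mono_set (hmono hij)).comp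
    (tendsto_add_atTop_nat 1)

lemma setLIntegral_exp_hitTime_eq {P : Measure Ω} [IsProbabilityMeasure P] {B : ℝ → Ω → ℝ}
    (hB : IsBrownianMotion P B) (hc : ∀ ω, Continuous fun t => B t ω) (h0 : ∀ ω, B 0 ω = 0)
    {a a' c : ℝ} (hcpos : 0 < c) (ha : 0 ≤ a) (haa : a ≤ a') {A : Set Ω}
    (hA : MeasurableSet[hitPast B hc a] A) :
    ∫⁻ ω in A ∩ {ω | ∃ s, 0 ≤ s ∧ a ≤ B s ω},
        ENNReal.ofReal (exp (c * a - c ^ 2 / 2 * hitTime (fun t => B t ω) a)) ∂P =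
      ∫⁻ ω in A ∩ {ω | ∃ s, 0 ≤ s ∧ a' ≤ B s ω},
        ENNReal.ofReal (exp (c * a' - c ^ 2 / 2 * hitTime (fun t => B t ω) a')) ∂P := by
  have hA' : MeasurableSet[hitPast B hc a'] A := hitPast_mono hc haa _ hA
  have L1 := tendsto_setLIntegral_reachEvent (P := P) (B := B) a A fun ω =>
    ENNReal.ofReal (exp (c * a - c ^ 2 / 2 * hitTime (fun t => B t ω) a))
  have L2 := tendsto_setLIntegral_reachEvent (P := P) (B := B) a' A fun ω =>
    ENNReal.ofReal (exp (c * a' - c ^ 2 / 2 * hitTime (fun t => B t ω) a'))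
  have hpos : ∀ n : ℕ, (0 : ℝ) < (n + 1 : ℕ) := fun n => by positivity
  simp only [← setLIntegral_exp_stopped hB hc h0 c ha (hpos _) hA] at L1
  simp only [← setLIntegral_exp_stopped hB hc h0 c (ha.trans haa) (hpos _) hA'] at L2
  have herr : Tendsto (fun n : ℕ => ENNReal.ofReal (exp (c * a' - c ^ 2 / 2 * (n + 1 : ℕ))))
      atTop (𝓝 0) := by
    rw [← ENNReal.ofReal_zero]
    refine ENNReal.tendsto_ofReal (tendsto_exp_atBot.comp ?_)
    have h1 : Tendsto (fun n : ℕ => ((n + 1 : ℕ) : ℝ)) atTop atTop :=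
      tendsto_natCast_atTop_atTop.comp (tendsto_add_atTop_nat 1)
    have h2 := h1.const_mul_atTop (show 0 < c ^ 2 / 2 by positivity)
    simpa only [sub_eq_add_neg, Function.comp_def] using
      tendsto_atBot_add_const_left atTop (c * a') (tendsto_neg_atTop_atBot.comp h2)
  have L3 := L2.add herr
  rw [add_zero] at L3
  refine le_antisymm (le_of_tendsto_of_tendsto' L1 L3 fun n => ?_)
    (le_of_tendsto_of_tendsto' L2 L1 fun n => lintegral_mono_set
      (inter_subset_inter_right _ (reachEvent_anti_left haa)))
  set N : ℝ := ((n + 1 : ℕ) : ℝ)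
  have hE : MeasurableSet (A ∩ reachEvent B a' N) := past_le hB.measurable N _ (hA'.2 N)
  have hE0 : MeasurableSet (A ∩ reachEvent B a N) := past_le hB.measurable N _ (hA.2 N)
  have hsub : A ∩ reachEvent B a N ⊆
      (A ∩ reachEvent B a' N) ∪ ((A ∩ reachEvent B a N) \ (A ∩ reachEvent B a' N)) := by
    intro ω hω
    by_cases h : ω ∈ A ∩ reachEvent B a' N
    · exact Or.inl h
    · exact Or.inr ⟨hω, h⟩
  refine (lintegral_mono_set hsub).trans ((lintegral_union_le _ _ _).trans
    (add_le_add le_rfl ?_))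
  calc _ ≤ ∫⁻ _ in (A ∩ reachEvent B a N) \ (A ∩ reachEvent B a' N),
        ENNReal.ofReal (exp (c * a' - c ^ 2 / 2 * N)) ∂P := by
        refine setLIntegral_mono' (hE0.diff hE) fun ω hω => ?_
        have : B N ω ≤ a' := le_of_not_gt fun h =>
          hω.2 ⟨hω.1.1, N, ⟨by positivity, le_rfl⟩, h.le⟩
        gcongr
    _ ≤ _ := by
        rw [setLIntegral_const]
        exact mul_le_of_le_one_right' prob_le_one

lemma ae_forall_level_reached {P : Measure Ω} [IsProbabilityMeasure P] {B : ℝ → Ω → ℝ}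
    (hB : IsBrownianMotion P B) (hc : ∀ ω, Continuous fun t => B t ω) (h0 : ∀ ω, B 0 ω = 0) :
    ∀ᵐ ω ∂P, ∀ a, ∃ s, 0 ≤ s ∧ a ≤ B s ω := by
  have hlevel : ∀ n : ℕ, ∀ᵐ ω ∂P, ∃ s, 0 ≤ s ∧ (n : ℝ) ≤ B s ω := fun n => by
    have hm : MeasurableSet {ω | ∃ s, 0 ≤ s ∧ (n : ℝ) ≤ B s ω} := by
      rw [← iUnion_reachEvent]
      exact MeasurableSet.iUnion fun m : ℕ =>
        past_le hB.measurable m _ (measurableSet_reachEvent hc n m)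
    refine (mem_ae_iff_prob_eq_one hm).2 (le_antisymm prob_le_one ?_)
    have hbound : ∀ m : ℕ, ENNReal.ofReal (exp (-(1 / ((m : ℝ) + 1) * n))) ≤
        P {ω | ∃ s, 0 ≤ s ∧ (n : ℝ) ≤ B s ω} := fun m => by
      set c : ℝ := 1 / ((m : ℝ) + 1)
      have hcpos : 0 < c := by positivity
      have h := setLIntegral_exp_hitTime_eq hB hc h0 hcpos le_rfl n.cast_nonneg
        (@MeasurableSet.univ _ (hitPast B hc 0))
      have huniv : {ω | ∃ s, 0 ≤ s ∧ (0 : ℝ) ≤ B s ω} = univ :=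
        eq_univ_of_forall fun ω => ⟨0, le_rfl, (h0 ω).ge⟩
      have hzero : ∀ ω, hitTime (fun t => B t ω) 0 = 0 := fun ω =>
        hitTime_of_nonpos (h0 ω) le_rfl
      simp only [huniv, hzero, mul_zero, sub_zero, exp_zero,
        ENNReal.ofReal_one, univ_inter, setLIntegral_const, measure_univ, mul_one] at h
      have h1 : (1 : ℝ≥0∞) ≤ ENNReal.ofReal (exp (c * n)) *
          P {ω | ∃ s, 0 ≤ s ∧ (n : ℝ) ≤ B s ω} := by
        rw [h, ← setLIntegral_const]
        refine lintegral_mono fun ω => ?_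
        gcongr
        have := hitTime_nonneg (fun t => B t ω) n
        have : 0 ≤ c ^ 2 / 2 * hitTime (fun t => B t ω) n := by positivity
        linarith
      calc ENNReal.ofReal (exp (-(c * n)))
          ≤ ENNReal.ofReal (exp (-(c * n))) * (ENNReal.ofReal (exp (c * n)) *
            P {ω | ∃ s, 0 ≤ s ∧ (n : ℝ) ≤ B s ω}) := le_mul_of_one_le_right' h1
        _ = _ := by
          rw [← mul_assoc, ← ENNReal.ofReal_mul (exp_pos _).le, ← exp_add]
          simp
    have hlim : Tendsto (fun m : ℕ => ENNReal.ofReal (exp (-(1 / ((m : ℝ) + 1) * n)))) atTop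
        (𝓝 1) := by
      rw [← ENNReal.ofReal_one, ← exp_zero]
      refine ENNReal.tendsto_ofReal ((continuous_exp.tendsto 0).comp ?_)
      simpa using ((tendsto_one_div_add_atTop_nhds_zero_nat (𝕜 := ℝ)).mul_const (n : ℝ)).neg
    exact le_of_tendsto' hlim hbound
  filter_upwards [ae_all_iff.2 hlevel] with ω hω a
  obtain ⟨n, hn⟩ := exists_nat_ge a
  obtain ⟨s, hs, hns⟩ := hω n
  exact ⟨s, hs, hn.trans hns⟩

lemma setLIntegral_exp_hitTime_sub {P : Measure Ω} [IsProbabilityMeasure P] {B : ℝ → Ω → ℝ}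
    (hB : IsBrownianMotion P B) (hc : ∀ ω, Continuous fun t => B t ω) (h0 : ∀ ω, B 0 ω = 0)
    (hub : ∀ ω a, ∃ s, 0 ≤ s ∧ a ≤ B s ω)
    {a a' θ : ℝ} (hθ : 0 < θ) (ha : 0 ≤ a) (haa : a ≤ a') {A : Set Ω}
    (hA : MeasurableSet[hitPast B hc a] A) :
    ∫⁻ ω in A, ENNReal.ofReal (exp (-θ *
        (hitTime (fun t => B t ω) a' - hitTime (fun t => B t ω) a))) ∂P =
      P A * ENNReal.ofReal (exp (-(√(2 * θ) * (a' - a)))) := by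
  set c := √(2 * θ)
  have hcpos : 0 < c := by positivity
  have hcθ : c ^ 2 / 2 = θ := by rw [Real.sq_sqrt (by positivity)]; ring
  have hitm : ∀ d, Measurable[hitPast B hc d] fun ω => hitTime (fun t => B t ω) d :=
    fun d => measurable_hitTime hB.measurable hc d
  have hit : ∀ d, Measurable fun ω => hitTime (fun t => B t ω) d := fun d =>
    (hitm d).mono (hitPast_le hc d) le_rfl
  let f : ℝ → Ω → ℝ≥0∞ := fun d ω =>
    ENNReal.ofReal (exp (c * d - θ * hitTime (fun t => B t ω) d))
  have hf : ∀ d, Measurable (f d) := fun d => by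
    have := hit d
    fun_prop
  have htrim : (P.withDensity (f a)).trim (hitPast_le hc a) =
      (P.withDensity (f a')).trim (hitPast_le hc a) := by
    refine @Measure.ext _ (hitPast B hc a) _ _ fun C hC => ?_
    rw [trim_measurableSet_eq _ hC, trim_measurableSet_eq _ hC,
      withDensity_apply _ hC.1, withDensity_apply _ hC.1]
    have h := setLIntegral_exp_hitTime_eq hB hc h0 hcpos ha haa hC
    have huniv : ∀ d, {ω | ∃ s, 0 ≤ s ∧ d ≤ B s ω} = univ := fun d =>
      eq_univ_of_forall fun ω => hub ω d
    simpa only [huniv, inter_univ, hcθ] using h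
  let g : Ω → ℝ≥0∞ := A.indicator fun ω =>
    ENNReal.ofReal (exp (θ * hitTime (fun t => B t ω) a - c * a))
  have hg : Measurable[hitPast B hc a] g := by
    refine Measurable.indicator ?_ hA
    exact (show Measurable fun x => ENNReal.ofReal (exp (θ * x - c * a)) by fun_prop).comp (hitm a)
  have hg' : Measurable g := hg.mono (hitPast_le hc a) le_rfl
  have key := congrArg (fun ν => @lintegral _ (hitPast B hc a) ν g) htrim
  simp only [lintegral_trim (hitPast_le hc a) hg,
    lintegral_withDensity_eq_lintegral_mul P (hf _) hg'] at key
  have hprod : ∀ d, ∫⁻ ω, (f d * g) ω ∂P = ∫⁻ ω in A,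
      ENNReal.ofReal (exp (c * (d - a) -
        θ * (hitTime (fun t => B t ω) d - hitTime (fun t => B t ω) a))) ∂P := fun d => by
    rw [← lintegral_indicator hA.1]
    refine lintegral_congr fun ω => ?_
    by_cases hω : ω ∈ A
    · simp only [Pi.mul_apply, f, g, indicator_of_mem hω, ← ENNReal.ofReal_mul (exp_pos _).le,
        ← exp_add]
      congr 2
      ring
    · simp [g, hω]
  rw [hprod, hprod] at key
  simp only [sub_self, mul_zero, exp_zero, ENNReal.ofReal_one, setLIntegral_const, one_mul] at key
  have hma := hit a
  have hma' := hit a'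
  rw [key, mul_comm, ← lintegral_const_mul _ (by fun_prop)]
  refine lintegral_congr fun ω => ?_
  rw [← ENNReal.ofReal_mul (exp_pos _).le, ← exp_add]
  congr 2
  ring

open scoped NNReal BoundedContinuousFunction in
lemma ext_nnreal_of_lintegral_exp {ν ν' : Measure ℝ≥0} [IsFiniteMeasure ν] [IsFiniteMeasure ν']
    (h : ∀ n : ℕ, ∫⁻ x, ENNReal.ofReal (exp (-n * x)) ∂ν =
      ∫⁻ x, ENNReal.ofReal (exp (-n * x)) ∂ν') : ν = ν' := by
  let e : ℝ≥0 →ᵇ ℝ := BoundedContinuousFunction.ofNormedAddCommGroup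
    (fun x => exp (-(x : ℝ))) (by fun_prop) 1 fun x => by
      rw [Real.norm_eq_abs, abs_exp]
      exact exp_le_one_iff.2 (by simp)
  have he : ∀ x, e x = exp (-(x : ℝ)) := fun x => rfl
  let 𝓐 : StarSubalgebra ℝ (ℝ≥0 →ᵇ ℝ) :=
    { Algebra.adjoin ℝ {e} with
      star_mem' := fun {g} hg => by
        have : star g = g := by ext x; simp
        rwa [this] }
  refine ext_of_forall_mem_subalgebra_integral_eq_of_polish (A := 𝓐) ?_ fun g hg => ?_
  · intro x y hxy
    refine ⟨e, ⟨BoundedContinuousFunction.toContinuousMapStarₐ ℝ e,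
      ⟨e, Algebra.subset_adjoin rfl, rfl⟩, rfl⟩, fun hxy' => hxy ?_⟩
    rw [he, he, exp_eq_exp, neg_inj] at hxy'
    exact_mod_cast hxy'
  · have hg' : g ∈ Algebra.adjoin ℝ {e} := hg
    rw [Algebra.adjoin_singleton_eq_range_aeval] at hg'
    obtain ⟨p, rfl⟩ := hg'
    clear hg
    change ∫ x, (Polynomial.aeval e p) x ∂ν = ∫ x, (Polynomial.aeval e p) x ∂ν'
    induction p using Polynomial.induction_on' with
    | add p q hp hq =>
      simp only [map_add, BoundedContinuousFunction.add_apply]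
      rw [integral_add (BoundedContinuousFunction.integrable _ _)
        (BoundedContinuousFunction.integrable _ _), integral_add
        (BoundedContinuousFunction.integrable _ _) (BoundedContinuousFunction.integrable _ _),
        hp, hq]
    | monomial n r =>
      have hval : ∀ x, (Polynomial.aeval e (Polynomial.monomial n r)) x = r * exp (-n * x) := by
        intro x
        rw [Polynomial.aeval_monomial]
        simp [he, ← exp_nat_mul]
      have hint : ∀ ρ : Measure ℝ≥0, ∫ x : ℝ≥0, exp (-n * x) ∂ρ =
          (∫⁻ x : ℝ≥0, ENNReal.ofReal (exp (-n * x)) ∂ρ).toReal := fun ρ =>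
        integral_eq_lintegral_of_nonneg_ae (Eventually.of_forall fun _ => (exp_pos _).le)
          (by fun_prop)
      simp only [hval]
      rw [integral_const_mul, integral_const_mul, hint, hint, h]

lemma ext_of_lintegral_exp {ν ν' : Measure ℝ} [IsFiniteMeasure ν] [IsFiniteMeasure ν']
    (hν : ∀ᵐ x ∂ν, 0 ≤ x) (hν' : ∀ᵐ x ∂ν', 0 ≤ x)
    (h : ∀ n : ℕ, ∫⁻ x, ENNReal.ofReal (exp (-n * x)) ∂ν =
      ∫⁻ x, ENNReal.ofReal (exp (-n * x)) ∂ν') : ν = ν' := by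
  have hback : ∀ ρ : Measure ℝ, (∀ᵐ x ∂ρ, 0 ≤ x) →
      (ρ.map Real.toNNReal).map (fun x : NNReal => (x : ℝ)) = ρ := fun ρ hρ => by
    rw [Measure.map_map measurable_coe_nnreal_real measurable_real_toNNReal]
    conv_rhs => rw [← Measure.map_id (μ := ρ)]
    exact Measure.map_congr (hρ.mono fun x hx => by simp [hx])
  have hlap : ∀ ρ : Measure ℝ, (∀ᵐ x ∂ρ, 0 ≤ x) → ∀ n : ℕ,
      ∫⁻ x, ENNReal.ofReal (exp (-n * x)) ∂(ρ.map Real.toNNReal) =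
        ∫⁻ x, ENNReal.ofReal (exp (-n * x)) ∂ρ := fun ρ hρ n => by
    rw [lintegral_map (by fun_prop) measurable_real_toNNReal]
    exact lintegral_congr_ae (hρ.mono fun x hx => by simp [hx])
  have heq : ν.map Real.toNNReal = ν'.map Real.toNNReal :=
    ext_nnreal_of_lintegral_exp fun n => by rw [hlap ν hν, hlap ν' hν', h]
  rw [← hback ν hν, ← hback ν' hν', heq]

lemma lintegral_exp_stableHalfLaw {t θ : ℝ} (ht : 0 < t) (hθ : 0 < θ) :
    ∫⁻ x, ENNReal.ofReal (exp (-θ * x)) ∂stableHalfLaw t = ENNReal.ofReal (exp (-t * √θ)) := by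
  rw [lintegral_stableHalfLaw t (by fun_prop), ← lintegral_exp_mul_stableHalfDensity ht hθ]
  simp only [mul_comm]

lemma ae_nonneg_stableHalfLaw (t : ℝ) : ∀ᵐ x ∂stableHalfLaw t, 0 ≤ x := by
  refine (withDensity_absolutelyContinuous _ _).ae_le ?_
  exact (ae_restrict_iff' measurableSet_Ioi).2 (Eventually.of_forall fun x hx => le_of_lt hx)

lemma map_hitTime_sub {P : Measure Ω} [IsProbabilityMeasure P] {B : ℝ → Ω → ℝ}
    (hB : IsBrownianMotion P B) (hc : ∀ ω, Continuous fun t => B t ω) (h0 : ∀ ω, B 0 ω = 0)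
    (hub : ∀ ω a, ∃ s, 0 ≤ s ∧ a ≤ B s ω) {s t : ℝ} (hs : 0 ≤ s) (hst : s < t) {A : Set Ω}
    (hA : MeasurableSet[hitPast B hc (s / √2)] A) :
    (P.restrict A).map (fun ω => hitTime (fun u => B u ω) (t / √2) -
      hitTime (fun u => B u ω) (s / √2)) = P A • stableHalfLaw (t - s) := by
  have hts : 0 < t - s := sub_pos.2 hst
  have := isProbabilityMeasure_stableHalfLaw hts
  have hit : ∀ d, Measurable fun ω => hitTime (fun t => B t ω) d := fun d =>
    (measurable_hitTime hB.measurable hc d).mono (hitPast_le hc d) le_rfl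
  have hm : Measurable fun ω => hitTime (fun u => B u ω) (t / √2) -
      hitTime (fun u => B u ω) (s / √2) := (hit _).sub (hit _)
  have hle : s / √2 ≤ t / √2 := by gcongr
  have : IsFiniteMeasure (P A • stableHalfLaw (t - s)) :=
    ⟨by simp [measure_lt_top]⟩
  refine ext_of_lintegral_exp ?_ ?_ fun n => ?_
  · refine (ae_map_iff hm.aemeasurable measurableSet_Ici).2 (Eventually.of_forall fun ω => ?_)
    exact sub_nonneg.2 (hitTime_mono (hc ω) hle (hub ω _))
  · exact Measure.ae_smul_measure (ae_nonneg_stableHalfLaw _) _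
  · rw [lintegral_map (by fun_prop) hm, lintegral_smul_measure, smul_eq_mul]
    rcases n.eq_zero_or_pos with rfl | hn
    · simp
    have hθ : (0 : ℝ) < n := by exact_mod_cast hn
    rw [setLIntegral_exp_hitTime_sub hB hc h0 hub hθ (by positivity) hle hA,
      lintegral_exp_stableHalfLaw hts hθ]
    congr 3
    rw [Real.sqrt_mul zero_le_two]
    have : √2 ≠ 0 := by positivity
    field_simp

lemma measurable_min_hitTime {E : Type*} (m : MeasurableSpace E) {B : ℝ → E → ℝ}
    (hc : ∀ ω, Continuous fun t => B t ω) (hub : ∀ ω a, ∃ s, 0 ≤ s ∧ a ≤ B s ω)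
    {φ : ℝ → ℝ} (hφ : Measurable φ)
    (hit : ∀ a, (∃ u, a < φ u) → Measurable fun ω => hitTime (fun t => B t ω) a) :
    Measurable fun p : ℝ × E => hitTime (fun t => B t p.2) (φ p.1) := by
  refine measurable_of_Ioi fun r => ?_
  have : (fun p : ℝ × E => hitTime (fun t => B t p.2) (φ p.1)) ⁻¹' Ioi r =
      ⋃ v : ℚ, {u | (v : ℝ) < φ u} ×ˢ {ω | r < hitTime (fun t => B t ω) v} := by
    ext ⟨u, ω⟩
    simp only [mem_preimage, mem_Ioi, mem_iUnion, mem_prod, mem_ofPred_eq]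
    exact lt_hitTime_iff (hc ω) (hub ω) _ _
  rw [this]
  refine MeasurableSet.iUnion fun v => ?_
  by_cases hv : ∃ u, (v : ℝ) < φ u
  · exact (measurableSet_lt measurable_const hφ).prod (hit v hv measurableSet_Ioi)
  · have : {u | (v : ℝ) < φ u} = ∅ := eq_empty_of_forall_notMem fun u hu => hv ⟨u, hu⟩
    simp [this]

lemma isStableHalfProcess_hitTime {P : Measure Ω} [IsProbabilityMeasure P] {B : ℝ → Ω → ℝ}
    (hB : IsBrownianMotion P B) (hc : ∀ ω, Continuous fun t => B t ω) (h0 : ∀ ω, B 0 ω = 0)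
    (hub : ∀ ω a, ∃ s, 0 ≤ s ∧ a ≤ B s ω) :
    IsStableHalfProcess P (fun t ω => hitTime (fun u => B u ω) (t / √2))
      (fun s => hitPast B hc (s / √2)) where
  zero ω := hitTime_of_nonpos (h0 ω) (by simp)
  measurable := measurable_min_hitTime _ hc hub (φ := fun t => t / √2) (by fun_prop) fun a _ =>
    (measurable_hitTime hB.measurable hc a).mono (hitPast_le hc a) le_rfl
  le s := hitPast_le hc _
  prog s _ := measurable_min_hitTime (hitPast B hc (s / √2)) hc hub (φ := fun t => min t s / √2)
    (by fun_prop) fun a ⟨u, hu⟩ => (measurable_hitTime hB.measurable hc a).mono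
      (hitPast_mono hc (hu.le.trans (by gcongr; exact min_le_right _ _))) le_rfl
  map_increment s t hs hst A hA := map_hitTime_sub hB hc h0 hub hs hst hA

/-- **Double Laplace transform of the sojourn time of the `(1/2)`-stable subordinator
with drift `-μ`.** With `b = 1/(4μ)`, for all `q, λ > 0`,
`∫_0^∞ e^{-qt} E[e^{-λ A_t^{(-μ)}}] dt = (1/(q+λ)) ((√b + √(q+λ+b))/(√b + √(q+b)))²`. -/
theorem half_stable_drift_double_laplace (P : Measure Ω) [IsProbabilityMeasure P]
    (B : ℝ → Ω → ℝ) (hB : IsBrownianMotion P B) (μ : ℝ) (hμ : 0 < μ)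
    (b : ℝ) (hb : b = 1 / (4 * μ)) (q lam : ℝ) (hq : 0 < q) (hlam : 0 < lam) :
    ∫ t in Set.Ioi (0:ℝ), Real.exp (-q * t) * ∫ ω, Real.exp (-lam * sojournDrift B μ t ω) ∂P
      = (1 / (q + lam)) *
        ((Real.sqrt b + Real.sqrt (q + lam + b)) / (Real.sqrt b + Real.sqrt (q + b))) ^ 2 := by
  obtain ⟨B₁, hB₁, heq₁, hp₁⟩ := hB.exists_modification
    (p := fun x => Continuous x ∧ x 0 = 0) (hB.cont.and hB.start) ⟨continuous_id, rfl⟩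
  obtain ⟨B₂, hB₂, heq₂, hp₂⟩ := hB₁.exists_modification
    (p := fun x => (Continuous x ∧ x 0 = 0) ∧ ∀ a, ∃ s, 0 ≤ s ∧ a ≤ x s)
    ((Eventually.of_forall hp₁).and
      (ae_forall_level_reached hB₁ (fun ω => (hp₁ ω).1) fun ω => (hp₁ ω).2))
    ⟨⟨continuous_id, rfl⟩, fun a => ⟨max a 0, le_max_right _ _, le_max_left _ _⟩⟩
  refine (isStableHalfProcess_hitTime hB₂ (fun ω => (hp₂ ω).1.1) (fun ω => (hp₂ ω).1.2)
    fun ω => (hp₂ ω).2).double_laplace (D := stableHalfSubordinator B) ?_ hμ hb hq hlam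
  filter_upwards [heq₁, heq₂] with ω h₁ h₂ s hs
  simp only [stableHalfSubordinator, ← h₁, ← h₂]
  exact sInf_eq_hitTime (hp₂ ω).1.1 (hp₂ ω).1.2 (by positivity) ((hp₂ ω).2 _)

end
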